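/- arXiv:2508.12789 — 4 statements merged into one kernel-verified Lean document; each statement's English description precedes it below -/
import Mathlib

section
/- Let n > 5 and let B be a saturated blocker of size n−1 of the convex n-gon. Then there exists a blocker B′ of the n-gon with exactly n−2 edges such that the symmetric difference B △ B′ contains at most 5 edges. -/
open Finset

namespace ConvexBlocker

/-- `c` lies strictly inside the (positively oriented) open arc from `a` to `b`. -/
def Btw (n : ℕ) (a c b : ZMod n) : Prop :=
  0 < (c - a).val ∧ (c - a).val < (b - a).val

/-- Two edges of the convex `n`-gon cross: their endpoints are four pairwise distinct
vertices which interleave in the cyclic order. -/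
def Cross (n : ℕ) (e f : Sym2 (ZMod n)) : Prop :=
  ∃ a b c d : ZMod n, e = s(a, b) ∧ f = s(c, d) ∧
    0 < (c - a).val ∧ (c - a).val < (b - a).val ∧ (b - a).val < (d - a).val

/-- `e` is an edge (an unordered pair of distinct vertices) of the `n`-gon. -/
def IsEdge (n : ℕ) (e : Sym2 (ZMod n)) : Prop :=
  ∃ a b : ZMod n, e = s(a, b) ∧ a ≠ b

/-- `e` is a diagonal of the convex `n`-gon: an edge of order at least 2, i.e. both open
arcs between its endpoints are nonempty. -/
def IsDiagonal (n : ℕ) (e : Sym2 (ZMod n)) : Prop :=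
  ∃ a b : ZMod n, e = s(a, b) ∧ a ≠ b ∧ (∃ c, Btw n a c b) ∧ (∃ d, Btw n b d a)

/-- A triangulation of the convex `n`-gon: an inclusion-maximal set of pairwise
non-crossing diagonals. -/
def IsTriangulation (n : ℕ) (T : Finset (Sym2 (ZMod n))) : Prop :=
  (∀ e ∈ T, IsDiagonal n e) ∧
  (∀ e ∈ T, ∀ f ∈ T, ¬ Cross n e f) ∧
  (∀ e, IsDiagonal n e → e ∉ T → ∃ f ∈ T, Cross n e f)

/-- A blocker of the convex `n`-gon: a set of edges meeting every triangulation. -/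
def IsBlocker (n : ℕ) (B : Finset (Sym2 (ZMod n))) : Prop :=
  (∀ e ∈ B, IsEdge n e) ∧
  ∀ T : Finset (Sym2 (ZMod n)), IsTriangulation n T → (B ∩ T).Nonempty

/-- A saturated blocker of the convex `n`-gon. -/
def IsSaturatedBlocker (n : ℕ) (B : Finset (Sym2 (ZMod n))) : Prop :=
  IsBlocker n B ∧ ∀ e ∈ B, ¬ IsBlocker n (B.erase e)

/-- `e` is an edge of the sub-polygon on the vertex set `S`. -/
def IsEdgeOn (n : ℕ) (S : Finset (ZMod n)) (e : Sym2 (ZMod n)) : Prop :=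
  ∃ a b : ZMod n, e = s(a, b) ∧ a ∈ S ∧ b ∈ S ∧ a ≠ b

/-- `e` is a diagonal of the sub-polygon on `S` (with the inherited cyclic order):
its endpoints are distinct members of `S` which are not cyclically consecutive in `S`. -/
def IsDiagonalOn (n : ℕ) (S : Finset (ZMod n)) (e : Sym2 (ZMod n)) : Prop :=
  ∃ a b : ZMod n, e = s(a, b) ∧ a ∈ S ∧ b ∈ S ∧ a ≠ b ∧
    (∃ c ∈ S, Btw n a c b) ∧ (∃ d ∈ S, Btw n b d a)

/-- A triangulation of the sub-polygon on `S`. -/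
def IsTriangulationOn (n : ℕ) (S : Finset (ZMod n)) (T : Finset (Sym2 (ZMod n))) : Prop :=
  (∀ e ∈ T, IsDiagonalOn n S e) ∧
  (∀ e ∈ T, ∀ f ∈ T, ¬ Cross n e f) ∧
  (∀ e, IsDiagonalOn n S e → e ∉ T → ∃ f ∈ T, Cross n e f)

/-- A blocker of the sub-polygon on `S`. -/
def IsBlockerOn (n : ℕ) (S : Finset (ZMod n)) (B : Finset (Sym2 (ZMod n))) : Prop :=
  (∀ e ∈ B, IsEdgeOn n S e) ∧
  ∀ T : Finset (Sym2 (ZMod n)), IsTriangulationOn n S T → (B ∩ T).Nonempty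

/-- A saturated blocker of the sub-polygon on `S`. -/
def IsSaturatedBlockerOn (n : ℕ) (S : Finset (ZMod n)) (B : Finset (Sym2 (ZMod n))) : Prop :=
  IsBlockerOn n S B ∧ ∀ e ∈ B, ¬ IsBlockerOn n S (B.erase e)

/-- The degree of the vertex `v` in the set of edges `B`. -/
noncomputable def degB (n : ℕ) (B : Finset (Sym2 (ZMod n))) (v : ZMod n) : ℕ :=
  (B.filter (fun e => v ∈ e)).card

section Geometry

variable {n : ℕ}

theorem exists_third {α : Type*} [DecidableEq α] {S : Finset α} {a b : α}
    (hS : 3 ≤ S.card) : ∃ c ∈ S, c ≠ a ∧ c ≠ b := by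
  by_contra! h
  have : S ⊆ {a, b} := by
    intro c hc
    simp only [Finset.mem_insert, Finset.mem_singleton]
    by_cases hca : c = a
    · exact Or.inl hca
    · exact Or.inr (h c hc hca)
  have := (Finset.card_le_card this).trans Finset.card_le_two
  omega

theorem isEdgeOn_iff (S : Finset (ZMod n)) (a b : ZMod n) : IsEdgeOn n S s(a, b) ↔
    a ∈ S ∧ b ∈ S ∧ a ≠ b := by
  constructor
  · rintro ⟨a', b', h1, h2, h3, h4⟩
    rw [Sym2.eq_iff] at h1
    rcases h1 with ⟨rfl, rfl⟩ | ⟨rfl, rfl⟩ <;> tauto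
  · rintro ⟨h2, h3, h4⟩
    exact ⟨a, b, rfl, h2, h3, h4⟩

/-- `a` and `b` are joined by a side of the sub-polygon on `S`. -/
def Adj (S : Finset (ZMod n)) (a b : ZMod n) : Prop :=
  a ∈ S ∧ b ∈ S ∧ a ≠ b ∧ ((∀ c ∈ S, ¬ Btw n a c b) ∨ (∀ c ∈ S, ¬ Btw n b c a))

variable {S : Finset (ZMod n)}

theorem Adj.symm {a b : ZMod n} (h : Adj S a b) : Adj S b a :=
  ⟨h.2.1, h.1, h.2.2.1.symm, h.2.2.2.symm⟩

theorem Adj.erase {a b i : ZMod n} (h : Adj S a b) (ha : a ≠ i) (hb : b ≠ i) :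
    Adj (S.erase i) a b := by
  obtain ⟨h1, h2, h3, h4⟩ := h
  refine ⟨Finset.mem_erase.2 ⟨ha, h1⟩, Finset.mem_erase.2 ⟨hb, h2⟩, h3, ?_⟩
  exact h4.imp (fun h c hc => h c (Finset.mem_of_mem_erase hc))
    (fun h c hc => h c (Finset.mem_of_mem_erase hc))

variable [NeZero n]

theorem btw_iff (a c b : ZMod n) : Btw n a c b ↔
    (a.val < c.val ∧ c.val < b.val) ∨ (c.val < b.val ∧ b.val < a.val) ∨
      (b.val < a.val ∧ a.val < c.val) := by
  have key : ∀ x y : ZMod n, y.val ≤ x.val ∧ (x - y).val = x.val - y.val ∨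
      x.val < y.val ∧ (x - y).val = x.val + n - y.val := by
    intro x y
    rcases le_or_gt y.val x.val with h | h
    · exact Or.inl ⟨h, ZMod.val_sub h⟩
    · right
      refine ⟨h, ?_⟩
      have h1 : y - x ≠ 0 := by
        intro h0
        rw [sub_eq_zero] at h0
        subst h0
        exact lt_irrefl _ h
      have : NeZero (y - x) := ⟨h1⟩
      rw [← neg_sub, ZMod.val_neg_of_ne_zero, ZMod.val_sub h.le]
      have := ZMod.val_lt y
      omega
  unfold Btw
  have ha := ZMod.val_lt a
  have hb := ZMod.val_lt b
  have hc := ZMod.val_lt c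
  rcases key c a with ⟨h1, h2⟩ | ⟨h1, h2⟩ <;> rcases key b a with ⟨h3, h4⟩ | ⟨h3, h4⟩ <;>
    rw [h2, h4] <;> omega

theorem val_ne {a b : ZMod n} (h : a ≠ b) : a.val ≠ b.val :=
  fun h' => h (ZMod.val_injective n h')

theorem Btw.ne {a c b : ZMod n} (h : Btw n a c b) : a ≠ c ∧ c ≠ b ∧ a ≠ b := by
  rw [btw_iff] at h
  refine ⟨?_, ?_, ?_⟩ <;> rintro rfl <;> omega

theorem cross_iff (a b c d : ZMod n) : Cross n s(a, b) s(c, d) ↔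
    (Btw n a c b ∧ Btw n b d a) ∨ (Btw n a d b ∧ Btw n b c a) := by
  have key : ∀ a b c d : ZMod n, (0 < (c - a).val ∧ (c - a).val < (b - a).val ∧
      (b - a).val < (d - a).val) ↔ (Btw n a c b ∧ Btw n b d a) := by
    intro a b c d
    have e : (0 < (c - a).val ∧ (c - a).val < (b - a).val ∧
      (b - a).val < (d - a).val) ↔ (Btw n a c b ∧ Btw n a b d) := by
      unfold Btw; omega
    rw [e, btw_iff, btw_iff, btw_iff]
    omega
  constructor
  · rintro ⟨a', b', c', d', h1, h2, h3⟩
    have h3 := (key _ _ _ _).1 h3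
    rw [Sym2.eq_iff] at h1 h2
    rcases h1 with ⟨rfl, rfl⟩ | ⟨rfl, rfl⟩ <;> rcases h2 with ⟨rfl, rfl⟩ | ⟨rfl, rfl⟩ <;> tauto
  · rintro (h | h)
    · exact ⟨a, b, c, d, rfl, rfl, (key _ _ _ _).2 h⟩
    · exact ⟨a, b, d, c, rfl, Sym2.eq_swap, (key _ _ _ _).2 h⟩

theorem isDiagonalOn_iff (S : Finset (ZMod n)) (a b : ZMod n) : IsDiagonalOn n S s(a, b) ↔
    a ∈ S ∧ b ∈ S ∧ (∃ c ∈ S, Btw n a c b) ∧ (∃ d ∈ S, Btw n b d a) := by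
  constructor
  · rintro ⟨a', b', h1, h2, h3, -, h4, h5⟩
    rw [Sym2.eq_iff] at h1
    rcases h1 with ⟨rfl, rfl⟩ | ⟨rfl, rfl⟩ <;> tauto
  · rintro ⟨h2, h3, ⟨c, hc, h4⟩, h5⟩
    exact ⟨a, b, rfl, h2, h3, h4.ne.2.2, ⟨c, hc, h4⟩, h5⟩

theorem Adj.not_isDiagonalOn {a b : ZMod n} (h : Adj S a b) : ¬ IsDiagonalOn n S s(a, b) := by
  rw [isDiagonalOn_iff]
  rintro ⟨-, -, ⟨c, hc, h1⟩, ⟨d, hd, h2⟩⟩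
  rcases h.2.2.2 with h3 | h3
  · exact h3 c hc h1
  · exact h3 d hd h2

theorem isDiagonalOn_of_not_adj {a b : ZMod n} (ha : a ∈ S) (hb : b ∈ S) (hab : a ≠ b)
    (h : ¬ Adj S a b) : IsDiagonalOn n S s(a, b) := by
  rw [isDiagonalOn_iff]
  refine ⟨ha, hb, ?_, ?_⟩ <;> by_contra hc <;> push Not at hc <;>
    exact h ⟨ha, hb, hab, by tauto⟩

/-- The successor of a vertex in the cyclic order of `S`. -/
theorem exists_next {a : ZMod n} (ha : a ∈ S) (hS : 2 ≤ S.card) :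
    ∃ b ∈ S, a ≠ b ∧ ∀ c ∈ S, ¬ Btw n a c b := by
  have hne : (S.erase a).Nonempty := by
    rw [← Finset.card_pos, Finset.card_erase_of_mem ha]; omega
  obtain ⟨b, hb, hmin⟩ := Finset.exists_min_image (S.erase a) (fun b => (b - a).val) hne
  rw [Finset.mem_erase] at hb
  refine ⟨b, hb.2, hb.1.symm, fun c hc hbt => ?_⟩
  have := hmin c (Finset.mem_erase.2 ⟨hbt.ne.1.symm, hc⟩)
  exact absurd hbt.2 (not_lt.2 this)

theorem exists_prev {a : ZMod n} (ha : a ∈ S) (hS : 2 ≤ S.card) :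
    ∃ b ∈ S, a ≠ b ∧ ∀ c ∈ S, ¬ Btw n b c a := by
  have hne : (S.erase a).Nonempty := by
    rw [← Finset.card_pos, Finset.card_erase_of_mem ha]; omega
  obtain ⟨b, hb, hmax⟩ := Finset.exists_max_image (S.erase a) (fun b => (b - a).val) hne
  rw [Finset.mem_erase] at hb
  refine ⟨b, hb.2, hb.1.symm, fun c hc hbt => ?_⟩
  have h1 := hmax c (Finset.mem_erase.2 ⟨hbt.ne.2.1, hc⟩)
  have h2 : Btw n a b c := by
    rw [btw_iff] at hbt ⊢; omega
  exact absurd h2.2 (not_lt.2 h1)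

theorem exists_nbrs {i : ZMod n} (hi : i ∈ S) (hS : 3 ≤ S.card) :
    ∃ h j, Adj S h i ∧ Adj S i j ∧ h ≠ j := by
  obtain ⟨j, hj, hij, h1⟩ := exists_next hi (by omega)
  obtain ⟨h, hh, hih, h2⟩ := exists_prev hi (by omega)
  refine ⟨h, j, ⟨hh, hi, hih.symm, Or.inl h2⟩, ⟨hi, hj, hij, Or.inl h1⟩, ?_⟩
  rintro rfl
  obtain ⟨c, hc, hci, hch⟩ := exists_third (a := i) (b := h) hS
  have := h1 c hc
  have := h2 c hc
  rw [btw_iff] at *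
  have := val_ne hci
  have := val_ne hch
  have := val_ne hij
  omega

theorem next_unique {b a c : ZMod n} (ha : a ∈ S) (hc : c ∈ S) (hba : b ≠ a) (hbc : b ≠ c)
    (h1 : ∀ x ∈ S, ¬ Btw n b x a) (h2 : ∀ x ∈ S, ¬ Btw n b x c) : a = c := by
  by_contra hac
  have e1 := val_ne hba
  have e2 := val_ne hbc
  have e3 := val_ne hac
  have h3 := h1 c hc
  have h4 := h2 a ha
  rw [btw_iff] at h3 h4
  omega

theorem prev_unique {b a c : ZMod n} (ha : a ∈ S) (hc : c ∈ S) (hba : b ≠ a) (hbc : b ≠ c)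
    (h1 : ∀ x ∈ S, ¬ Btw n a x b) (h2 : ∀ x ∈ S, ¬ Btw n c x b) : a = c := by
  by_contra hac
  have e1 := val_ne hba
  have e2 := val_ne hbc
  have e3 := val_ne hac
  have h3 := h1 c hc
  have h4 := h2 a ha
  rw [btw_iff] at h3 h4
  omega

theorem adj_unique {b a c d : ZMod n} (ha : Adj S b a) (hc : Adj S b c) (hd : Adj S b d)
    (hac : a ≠ c) : d = a ∨ d = c := by
  obtain ⟨hb, haS, hba, ha⟩ := ha
  obtain ⟨-, hcS, hbc, hc⟩ := hc
  obtain ⟨-, hdS, hbd, hd⟩ := hd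
  rcases ha with ha | ha <;> rcases hc with hc | hc
  · exact absurd (next_unique haS hcS hba hbc ha hc) hac
  · rcases hd with hd | hd
    · exact Or.inl (next_unique hdS haS hbd hba hd ha)
    · exact Or.inr (prev_unique hdS hcS hbd hbc hd hc)
  · rcases hd with hd | hd
    · exact Or.inr (next_unique hdS hcS hbd hbc hd hc)
    · exact Or.inl (prev_unique hdS haS hbd hba hd ha)
  · exact absurd (prev_unique haS hcS hba hbc ha hc) hac

theorem exists_adj_ne {a b : ZMod n} (h : Adj S a b) (hS : 3 ≤ S.card) :
    ∃ c, Adj S b c ∧ a ≠ c := by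
  obtain ⟨p, q, hp, hq, hpq⟩ := exists_nbrs h.2.1 hS
  rcases adj_unique hp.symm hq h.symm hpq with rfl | rfl
  · exact ⟨q, hq, hpq⟩
  · exact ⟨p, hp.symm, hpq.symm⟩

theorem Adj.erase_skip {h i j : ZMod n} (h1 : Adj S h i) (h2 : Adj S i j) (hj : h ≠ j) :
    Adj (S.erase i) h j := by
  obtain ⟨hh, hi, hhi, h1⟩ := h1
  obtain ⟨-, hj', hij, h2⟩ := h2
  refine ⟨Finset.mem_erase.2 ⟨hhi, hh⟩, Finset.mem_erase.2 ⟨hij.symm, hj'⟩, hj, ?_⟩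
  have e1 := val_ne hhi
  have e2 := val_ne hij
  have e3 := val_ne hj
  simp only [btw_iff] at h1 h2 ⊢
  rcases h1 with h1 | h1 <;> rcases h2 with h2 | h2
  · left
    intro c hc
    have e4 := val_ne (Finset.ne_of_mem_erase hc)
    have := h1 c (Finset.mem_of_mem_erase hc)
    have := h2 c (Finset.mem_of_mem_erase hc)
    omega
  · exfalso
    have := h1 _ hj'
    have := h2 _ hh
    omega
  · exfalso
    have := h1 _ hj'
    have := h2 _ hh
    omega
  · right
    intro c hc
    have e4 := val_ne (Finset.ne_of_mem_erase hc)
    have := h1 c (Finset.mem_of_mem_erase hc)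
    have := h2 c (Finset.mem_of_mem_erase hc)
    omega

theorem Adj.of_erase {i a b : ZMod n} (h : Adj (S.erase i) a b) (hi : i ∈ S) :
    Adj S a b ∨ (Adj S a i ∧ Adj S i b) := by
  obtain ⟨ha, hb, hab, h⟩ := h
  rw [Finset.mem_erase] at ha hb
  by_cases hadj : Adj S a b
  · exact Or.inl hadj
  right
  have hd := isDiagonalOn_of_not_adj ha.2 hb.2 hab hadj
  rw [isDiagonalOn_iff] at hd
  obtain ⟨-, -, ⟨c, hc, h1⟩, ⟨d, hd, h2⟩⟩ := hd
  have key : (∀ x ∈ S, Btw n a x b → x = i) ∧ Btw n a i b ∨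
      (∀ x ∈ S, Btw n b x a → x = i) ∧ Btw n b i a := by
    rcases h with h | h
    · left
      have : ∀ x ∈ S, Btw n a x b → x = i := fun x hx hbt => by
        by_contra hxi
        exact h x (Finset.mem_erase.2 ⟨hxi, hx⟩) hbt
      exact ⟨this, this c hc h1 ▸ h1⟩
    · right
      have : ∀ x ∈ S, Btw n b x a → x = i := fun x hx hbt => by
        by_contra hxi
        exact h x (Finset.mem_erase.2 ⟨hxi, hx⟩) hbt
      exact ⟨this, this d hd h2 ▸ h2⟩
  have aux : ∀ x : ZMod n, x ≠ i → x.val ≠ i.val := fun x hx => val_ne hx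
  rcases key with ⟨h3, h4⟩ | ⟨h3, h4⟩
  · refine ⟨⟨ha.2, hi, ha.1, Or.inl fun x hx hbt => ?_⟩,
      ⟨hi, hb.2, hb.1.symm, Or.inl fun x hx hbt => ?_⟩⟩
    · exact hbt.ne.2.1 (h3 x hx (by rw [btw_iff] at *; omega))
    · exact hbt.ne.1.symm (h3 x hx (by rw [btw_iff] at *; omega))
  · refine ⟨⟨ha.2, hi, ha.1, Or.inr fun x hx hbt => ?_⟩,
      ⟨hi, hb.2, hb.1.symm, Or.inr fun x hx hbt => ?_⟩⟩
    · exact hbt.ne.1.symm (h3 x hx (by rw [btw_iff] at *; omega))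
    · exact hbt.ne.2.1 (h3 x hx (by rw [btw_iff] at *; omega))

theorem Adj.orient {a b c : ZMod n} (h1 : Adj S a b) (h2 : Adj S b c) (hac : a ≠ c) :
    ((∀ x ∈ S, ¬ Btw n a x b) ∧ ∀ x ∈ S, ¬ Btw n b x c) ∨
      ((∀ x ∈ S, ¬ Btw n b x a) ∧ ∀ x ∈ S, ¬ Btw n c x b) := by
  obtain ⟨ha, hb, hab, h1⟩ := h1
  obtain ⟨-, hc, hbc, h2⟩ := h2
  rcases h1 with h1 | h1 <;> rcases h2 with h2 | h2
  · exact Or.inl ⟨h1, h2⟩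
  · exact absurd (prev_unique ha hc hab.symm hbc h1 h2) hac
  · exact absurd (next_unique ha hc hab.symm hbc h1 h2) hac
  · exact Or.inr ⟨h1, h2⟩

theorem ne_of_path_three {a b c d : ZMod n} (h1 : Adj S a b) (h2 : Adj S b c) (h3 : Adj S c d)
    (hac : a ≠ c) (hS : 4 ≤ S.card) : a ≠ d := by
  rintro rfl
  obtain ⟨x, hx, hxa, hxc⟩ := exists_third (S := S.erase b) (a := a) (b := c)
    (by rw [Finset.card_erase_of_mem h1.2.1]; omega)
  rw [Finset.mem_erase] at hx
  have o1 := h1.orient h2 hac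
  have o2 := h2.orient h3 h1.2.2.1.symm
  have e1 := val_ne h1.2.2.1
  have e2 := val_ne h2.2.2.1
  have e3 := val_ne hac
  have e4 := val_ne hxa
  have e5 := val_ne hxc
  have e6 := val_ne hx.1
  have hb := h1.2.1
  have ha := h1.1
  have hc := h2.2.1
  simp only [btw_iff] at o1 o2
  rcases o1 with ⟨h1, h2⟩ | ⟨h1, h2⟩ <;> rcases o2 with ⟨h3, h4⟩ | ⟨h3, h4⟩
  · have := h1 x hx.2
    have := h2 x hx.2
    have := h4 x hx.2
    omega
  · have := h2 a ha
    have := h3 a ha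
    omega
  · have := h2 a ha
    have := h3 a ha
    omega
  · have := h1 x hx.2
    have := h2 x hx.2
    have := h4 x hx.2
    omega

theorem ne_of_path_four {a b c d e : ZMod n} (h1 : Adj S a b) (h2 : Adj S b c) (h3 : Adj S c d)
    (h4 : Adj S d e) (hac : a ≠ c) (hbd : b ≠ d) (hS : 5 ≤ S.card) : a ≠ e := by
  have hbe := ne_of_path_three h2 h3 h4 hbd (by omega)
  exact ne_of_path_three (S := S.erase b) (h1.erase_skip h2 hac)
    (h3.erase h2.2.2.1.symm hbd.symm) (h4.erase hbd.symm hbe.symm)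
    (ne_of_path_three h1 h2 h3 hac (by omega))
    (by rw [Finset.card_erase_of_mem h1.2.1]; omega)

theorem ne_of_path_five {a b c d e f : ZMod n} (h1 : Adj S a b) (h2 : Adj S b c)
    (h3 : Adj S c d) (h4 : Adj S d e) (h5 : Adj S e f) (hac : a ≠ c) (hbd : b ≠ d) (hce : c ≠ e)
    (hS : 6 ≤ S.card) : a ≠ f := by
  have hbe := ne_of_path_three h2 h3 h4 hbd (by omega)
  have hbf := ne_of_path_four h2 h3 h4 h5 hbd hce (by omega)
  exact ne_of_path_four (S := S.erase b) (h1.erase_skip h2 hac)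
    (h3.erase h2.2.2.1.symm hbd.symm) (h4.erase hbd.symm hbe.symm)
    (h5.erase hbe.symm hbf.symm) (ne_of_path_three h1 h2 h3 hac (by omega)) hce
    (by rw [Finset.card_erase_of_mem h1.2.1]; omega)

theorem isDiagonalOn_skip {h i j : ZMod n} (h1 : Adj S h i) (h2 : Adj S i j) (hj : h ≠ j)
    (hS : 4 ≤ S.card) : IsDiagonalOn n S s(h, j) := by
  refine isDiagonalOn_of_not_adj h1.1 h2.2.1 hj fun h3 => ?_
  exact ne_of_path_three h1 h2 h3.symm hj hS rfl

end Geometry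

section Triangulations

variable {n : ℕ} {S : Finset (ZMod n)}

theorem Btw.trans {a b c d : ZMod n} (h1 : Btw n a b c) (h2 : Btw n a c d) : Btw n a b d :=
  ⟨h1.1, h1.2.trans h2.2⟩

variable [NeZero n]

theorem Btw.rotate {a c b : ZMod n} (h : Btw n a c b) : Btw n c b a := by
  rw [btw_iff] at h ⊢
  omega

theorem Btw.of_not {a c b : ZMod n} (h : ¬ Btw n a c b) (hac : a ≠ c) (hcb : c ≠ b)
    (hab : a ≠ b) : Btw n b c a := by
  have e1 := val_ne hac
  have e2 := val_ne hcb
  have e3 := val_ne hab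
  rw [btw_iff] at h ⊢
  omega

theorem Btw.trans_right {a b c d : ZMod n} (h1 : Btw n a b c) (h2 : Btw n a c d) :
    Btw n b c d := by
  rw [btw_iff] at *
  omega

theorem Cross.symm {e f : Sym2 (ZMod n)} (h : Cross n e f) : Cross n f e := by
  induction e using Sym2.ind with | _ a b
  induction f using Sym2.ind with | _ c d
  simp only [cross_iff, btw_iff] at h ⊢
  omega

theorem isDiagonalOn_of_cross {a b c d : ZMod n} (ha : a ∈ S) (hb : b ∈ S) (hc : c ∈ S)
    (hd : d ∈ S) (h : Cross n s(a, b) s(c, d)) : IsDiagonalOn n S s(c, d) := by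
  have h' := h.symm
  rw [cross_iff] at h'
  rw [isDiagonalOn_iff]
  rcases h' with ⟨h1, h2⟩ | ⟨h1, h2⟩
  · exact ⟨hc, hd, ⟨a, ha, h1⟩, ⟨b, hb, h2⟩⟩
  · exact ⟨hc, hd, ⟨b, hb, h1⟩, ⟨a, ha, h2⟩⟩

theorem cross_ear {h i j x : ZMod n} (h1 : Adj S h i) (h2 : Adj S i j) (hj : h ≠ j)
    (hx : x ∈ S) (hxi : x ≠ i) (hxh : x ≠ h) (hxj : x ≠ j) : Cross n s(i, x) s(h, j) := by
  rw [cross_iff]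
  rcases h1.orient h2 hj with ⟨o1, o2⟩ | ⟨o1, o2⟩
  · exact Or.inr ⟨(Btw.of_not (o2 x hx) hxi.symm hxj h2.2.2.1).rotate.rotate,
      (Btw.of_not (o1 x hx) hxh.symm hxi h1.2.2.1).rotate⟩
  · exact Or.inl ⟨(Btw.of_not (o1 x hx) hxi.symm hxh h1.2.2.1.symm).rotate.rotate,
      (Btw.of_not (o2 x hx) hxj.symm hxi h2.2.2.1.symm).rotate⟩

theorem Btw.eq_of_not {h i j x : ZMod n} (h1 : ¬ Btw n h x i) (h2 : ¬ Btw n i x j)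
    (hx : Btw n h x j) : x = i := by
  by_contra hne
  have e1 := val_ne hne
  rw [btw_iff] at h1 h2 hx
  omega

theorem eq_or_eq_of_cross_ear {h i j a b : ZMod n} (h1 : Adj S h i) (h2 : Adj S i j)
    (hj : h ≠ j) (ha : a ∈ S) (hb : b ∈ S) (hc : Cross n s(a, b) s(h, j)) : a = i ∨ b = i := by
  have hc' := hc.symm
  rw [cross_iff] at hc'
  rcases h1.orient h2 hj with ⟨o1, o2⟩ | ⟨o1, o2⟩
  · exact hc'.imp (fun q => Btw.eq_of_not (o1 a ha) (o2 a ha) q.1)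
      (fun q => Btw.eq_of_not (o1 b hb) (o2 b hb) q.1)
  · exact hc'.symm.imp (fun q => Btw.eq_of_not (o2 a ha) (o1 a ha) q.2)
      (fun q => Btw.eq_of_not (o2 b hb) (o1 b hb) q.2)

theorem IsDiagonalOn.of_erase {i : ZMod n} {e : Sym2 (ZMod n)}
    (h : IsDiagonalOn n (S.erase i) e) : IsDiagonalOn n S e ∧ i ∉ e := by
  induction e using Sym2.ind with | _ a b
  rw [isDiagonalOn_iff] at h ⊢
  simp only [Finset.mem_erase] at h
  obtain ⟨ha, hb, ⟨c, hc, h1⟩, ⟨d, hd, h2⟩⟩ := h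
  refine ⟨⟨ha.2, hb.2, ⟨c, hc.2, h1⟩, ⟨d, hd.2, h2⟩⟩, ?_⟩
  rw [Sym2.mem_iff]
  rintro (rfl | rfl)
  · exact ha.1 rfl
  · exact hb.1 rfl

/-- Gluing an ear to a triangulation of the polygon with a vertex removed. -/
theorem IsTriangulationOn.insert_ear {h i j : ZMod n} {T : Finset (Sym2 (ZMod n))}
    (hT : IsTriangulationOn n (S.erase i) T) (h1 : Adj S h i) (h2 : Adj S i j) (hj : h ≠ j)
    (hS : 4 ≤ S.card) : IsTriangulationOn n S (insert s(h, j) T) := by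
  obtain ⟨hd, hc, hm⟩ := hT
  have key : ∀ f, f ∈ T → ¬ Cross n f s(h, j) := by
    intro f hf hcr
    obtain ⟨q1, q2⟩ := (hd f hf).of_erase
    induction f using Sym2.ind with | _ a b
    rw [isDiagonalOn_iff] at q1
    rcases eq_or_eq_of_cross_ear h1 h2 hj q1.1 q1.2.1 hcr with rfl | rfl <;> simp at q2
  refine ⟨?_, ?_, ?_⟩
  · intro e he
    rcases Finset.mem_insert.1 he with rfl | he
    · exact isDiagonalOn_skip h1 h2 hj hS
    · exact (hd e he).of_erase.1
  · intro e he f hf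
    rcases Finset.mem_insert.1 he with rfl | he <;> rcases Finset.mem_insert.1 hf with rfl | hf
    · intro hcr
      rcases eq_or_eq_of_cross_ear h1 h2 hj h1.1 h2.2.1 hcr with q | q
      · exact h1.2.2.1 q
      · exact h2.2.2.1 q.symm
    · exact fun hcr => key f hf hcr.symm
    · exact key e he
    · exact hc e he f hf
  · have main : ∀ x, IsDiagonalOn n S s(i, x) → Cross n s(i, x) s(h, j) := by
      intro x hx
      have hx' := (isDiagonalOn_iff _ _ _).1 hx
      obtain ⟨c, -, hc⟩ := hx'.2.2.1
      refine cross_ear h1 h2 hj hx'.2.1 hc.ne.2.2.symm ?_ ?_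
      · rintro rfl
        exact h1.symm.not_isDiagonalOn hx
      · rintro rfl
        exact h2.not_isDiagonalOn hx
    intro e he hne
    rw [Finset.mem_insert, not_or] at hne
    by_cases hi : i ∈ e
    · obtain ⟨x, rfl⟩ := Sym2.mem_iff_exists.1 hi
      exact ⟨_, Finset.mem_insert_self _ _, main x he⟩
    · have : IsDiagonalOn n (S.erase i) e := by
        induction e using Sym2.ind with | _ a b
        rw [Sym2.mem_iff, not_or] at hi
        have he' := (isDiagonalOn_iff _ _ _).1 he
        obtain ⟨c, -, hc⟩ := he'.2.2.1
        refine isDiagonalOn_of_not_adj (Finset.mem_erase.2 ⟨Ne.symm hi.1, he'.1⟩)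
          (Finset.mem_erase.2 ⟨Ne.symm hi.2, he'.2.1⟩) hc.ne.2.2 fun hadj => ?_
        rcases hadj.of_erase h1.2.1 with q | ⟨q1, q2⟩
        · exact q.not_isDiagonalOn he
        · rcases adj_unique h1.symm h2 q1.symm hj with rfl | rfl <;>
            rcases adj_unique h1.symm h2 q2 hj with rfl | rfl
          · exact hc.ne.2.2 rfl
          · exact hne.1 rfl
          · exact hne.1 Sym2.eq_swap
          · exact hc.ne.2.2 rfl
      obtain ⟨f, hf, hcr⟩ := hm e this hne.2
      exact ⟨f, Finset.mem_insert_of_mem hf, hcr⟩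

theorem Adj.btw_shift {v w a b : ZMod n} (h : Adj S v w) (ha : a ∈ S) (hb : b ∈ S)
    (haw : a ≠ w) (hbw : b ≠ w) (hv : Btw n a v b) : Btw n a w b := by
  have e1 := val_ne haw
  have e2 := val_ne hbw
  have e3 := val_ne h.2.2.1
  rcases h.2.2.2 with o | o
  · have o := o b hb
    rw [btw_iff] at *
    omega
  · have o := o a ha
    rw [btw_iff] at *
    omega

theorem Adj.cross_shift {v w a b x : ZMod n} (h : Adj S v w) (ha : a ∈ S) (hb : b ∈ S)
    (haw : a ≠ w) (hbw : b ≠ w) (hc : Cross n s(a, b) s(v, x)) : Cross n s(a, b) s(w, x) := by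
  rw [cross_iff] at hc ⊢
  exact hc.imp (fun q => ⟨h.btw_shift ha hb haw hbw q.1, q.2⟩)
    (fun q => ⟨q.1, h.btw_shift hb ha hbw haw q.2⟩)

theorem cross_of_cross_of_cross {v w y z z' : ZMod n} (hy : ¬ Btw n v y w)
    (h1 : Cross n s(v, y) s(w, z)) (h2 : Cross n s(w, y) s(v, z')) :
    Cross n s(w, z) s(v, z') := by
  rw [cross_iff] at h1 h2 ⊢
  rcases h1 with ⟨q1, q2⟩ | ⟨-, q2⟩
  · rcases h2 with ⟨q3, -⟩ | ⟨q3, q4⟩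
    · exact absurd q3.rotate hy
    · have q5 : Btw n y z w := q2.trans q4
      exact Or.inr ⟨q3.trans q5.rotate.rotate, q2.trans_right q4⟩
  · exact absurd q2.rotate.rotate hy

/-- Contracting the side `vw` of a triangulated polygon to the vertex `v`. -/
theorem IsTriangulationOn.contract {v w : ZMod n} {T : Finset (Sym2 (ZMod n))}
    (hT : IsTriangulationOn n S T) (h : Adj S v w) :
    ∃ T', IsTriangulationOn n (S.erase w) T' ∧
      ∀ e ∈ T', e ∈ T ∨ ∃ x, e = s(v, x) ∧ s(w, x) ∈ T := by
  classical
  obtain ⟨hd, hc, hm⟩ := hT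
  let T' : Finset (Sym2 (ZMod n)) := Finset.univ.filter fun e =>
    IsDiagonalOn n (S.erase w) e ∧ (e ∈ T ∨ ∃ x, e = s(v, x) ∧ s(w, x) ∈ T)
  have mem : ∀ e, e ∈ T' ↔
      IsDiagonalOn n (S.erase w) e ∧ (e ∈ T ∨ ∃ x, e = s(v, x) ∧ s(w, x) ∈ T) := by
    simp [T']
  refine ⟨T', ⟨fun e he => ((mem e).1 he).1, ?_, ?_⟩, fun e he => ((mem e).1 he).2⟩
  · have key : ∀ e x, IsDiagonalOn n (S.erase w) e → e ∈ T → s(w, x) ∈ T →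
        ¬ Cross n e s(v, x) := by
      intro e x he heT hx hcr
      induction e using Sym2.ind with | _ a b
      rw [isDiagonalOn_iff, Finset.mem_erase, Finset.mem_erase] at he
      exact hc _ heT _ hx (h.cross_shift he.1.2 he.2.1.2 he.1.1 he.2.1.1 hcr)
    intro e he f hf
    rw [mem] at he hf
    obtain ⟨he1, he2⟩ := he
    obtain ⟨hf1, hf2⟩ := hf
    rcases he2 with he2 | ⟨x, rfl, hx⟩ <;> rcases hf2 with hf2 | ⟨y, rfl, hy⟩
    · exact hc e he2 f hf2
    · exact key e y he1 he2 hy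
    · exact fun hcr => key f x hf1 hf2 hx hcr.symm
    · rw [cross_iff, btw_iff, btw_iff, btw_iff, btw_iff]
      omega
  · have fin : ∀ e f, IsDiagonalOn n (S.erase w) e → f ∈ T → w ∉ f → Cross n e f →
        ∃ f ∈ T', Cross n e f := by
      intro e f he hf hwf hcr
      refine ⟨f, (mem f).2 ⟨?_, Or.inl hf⟩, hcr⟩
      have hfd := hd f hf
      induction e using Sym2.ind with | _ a b
      induction f using Sym2.ind with | _ c d
      rw [Sym2.mem_iff, not_or] at hwf
      rw [isDiagonalOn_iff] at he hfd
      exact isDiagonalOn_of_cross he.1 he.2.1 (Finset.mem_erase.2 ⟨Ne.symm hwf.1, hfd.1⟩)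
        (Finset.mem_erase.2 ⟨Ne.symm hwf.2, hfd.2.1⟩) hcr
    intro e he hne
    rw [mem, not_and, not_or] at hne
    obtain ⟨hne1, hne2⟩ := hne he
    obtain ⟨heS, hwe⟩ := he.of_erase
    obtain ⟨f, hf, hcr⟩ := hm e heS hne1
    by_cases hwf : w ∉ f
    · exact fin e f he hf hwf hcr
    rw [not_not] at hwf
    obtain ⟨z, rfl⟩ := Sym2.mem_iff_exists.1 hwf
    by_cases hve : v ∈ e
    · obtain ⟨y, rfl⟩ := Sym2.mem_iff_exists.1 hve
      have hwy : s(w, y) ∉ T := fun q => hne2 ⟨y, rfl, q⟩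
      have heS' := (isDiagonalOn_iff _ _ _).1 heS
      rw [Sym2.mem_iff, not_or] at hwe
      have hvy : v ≠ y := by
        obtain ⟨c, -, hc⟩ := heS'.2.2.1
        exact hc.ne.2.2
      have hdy : IsDiagonalOn n S s(w, y) := by
        refine isDiagonalOn_of_not_adj h.2.1 heS'.2.1 hwe.2 fun hadj => ?_
        exact (h.erase_skip hadj hvy).not_isDiagonalOn he
      obtain ⟨g, hg, hcr'⟩ := hm _ hdy hwy
      have hgd := hd g hg
      by_cases hvg : v ∈ g
      · exfalso
        obtain ⟨z', rfl⟩ := Sym2.mem_iff_exists.1 hvg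
        refine hc _ hf _ hg ?_
        rcases h.2.2.2 with o | o
        · exact cross_of_cross_of_cross (o y heS'.2.1) hcr hcr'
        · exact (cross_of_cross_of_cross (o y heS'.2.1) hcr' hcr).symm
      · induction g using Sym2.ind with | _ c d
        rw [Sym2.mem_iff, not_or] at hvg
        rw [isDiagonalOn_iff] at hgd
        refine fin _ _ he hg ?_ (h.symm.cross_shift hgd.1 hgd.2.1 (Ne.symm hvg.1)
          (Ne.symm hvg.2) hcr'.symm).symm
        rw [Sym2.mem_iff]
        simp only [cross_iff, btw_iff] at hcr'
        rintro (rfl | rfl) <;> omega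
    · have hzd := (isDiagonalOn_iff _ _ _).1 (hd _ hf)
      have hzw : z ≠ w := by
        obtain ⟨c, -, hc⟩ := hzd.2.2.1
        exact hc.ne.2.2.symm
      induction e using Sym2.ind with | _ a b
      rw [isDiagonalOn_iff] at heS
      rw [Sym2.mem_iff, not_or] at hve
      have hcr2 := h.symm.cross_shift heS.1 heS.2.1 (Ne.symm hve.1) (Ne.symm hve.2) hcr
      rw [isDiagonalOn_iff] at he
      exact ⟨s(v, z), (mem _).2 ⟨isDiagonalOn_of_cross he.1 he.2.1
        (Finset.mem_erase.2 ⟨h.2.2.1, h.1⟩) (Finset.mem_erase.2 ⟨hzw, hzd.2.1⟩) hcr2,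
        Or.inr ⟨z, rfl, hf⟩⟩, hcr2⟩

/-- A quadrilateral cut off by a diagonal of a triangulation contains one of its diagonals. -/
theorem IsTriangulationOn.quad {a b c d : ZMod n} {T : Finset (Sym2 (ZMod n))}
    (hT : IsTriangulationOn n S T) (h1 : Adj S a b) (h2 : Adj S b c) (h3 : Adj S c d)
    (hac : a ≠ c) (hbd : b ≠ d) (hS : 4 ≤ S.card) (had : s(a, d) ∈ T) :
    s(a, c) ∈ T ∨ s(b, d) ∈ T := by
  by_contra! hne
  obtain ⟨f, hf, hcr⟩ := hT.2.2 _ (isDiagonalOn_skip h1 h2 hac hS) hne.1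
  have hfd := hT.1 f hf
  have had' : a ≠ d := ne_of_path_three h1 h2 h3 hac hS
  have hbf : b ∈ f := by
    induction f using Sym2.ind with | _ p q
    rw [isDiagonalOn_iff] at hfd
    rw [Sym2.mem_iff]
    exact (eq_or_eq_of_cross_ear h1 h2 hac hfd.1 hfd.2.1 hcr.symm).imp Eq.symm Eq.symm
  obtain ⟨x, rfl⟩ := Sym2.mem_iff_exists.1 hbf
  have hx := ((isDiagonalOn_iff _ _ _).1 hfd).2.1
  have hne' : x ≠ b ∧ x ≠ a ∧ x ≠ c := by
    simp only [cross_iff, btw_iff] at hcr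
    refine ⟨?_, ?_, ?_⟩ <;> rintro rfl <;> omega
  have hxd : x ≠ d := by
    rintro rfl
    exact hne.2 hf
  exact hT.2.1 _ hf _ had (cross_ear (h1.erase hac h2.2.2.1) (h2.erase_skip h3 hbd) had'
    (Finset.mem_erase.2 ⟨hne'.2.2, hx⟩) hne'.1 hne'.2.1 hxd)

end Triangulations

section Blockers

variable {n : ℕ} {S : Finset (ZMod n)} {B M : Finset (Sym2 (ZMod n))}

/-- The edges of `B` avoiding the vertex `v`. -/
noncomputable def del (B : Finset (Sym2 (ZMod n))) (v : ZMod n) : Finset (Sym2 (ZMod n)) :=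
  B.filter fun e => v ∉ e

theorem mem_del {v : ZMod n} {e : Sym2 (ZMod n)} : e ∈ del B v ↔ e ∈ B ∧ v ∉ e :=
  Finset.mem_filter

theorem del_subset {v : ZMod n} : del B v ⊆ B := Finset.filter_subset _ _

theorem degB_add_card_del (B : Finset (Sym2 (ZMod n))) (v : ZMod n) :
    degB n B v + (del B v).card = B.card :=
  Finset.card_filter_add_card_filter_not _

theorem degB_mono (h : M ⊆ B) (v : ZMod n) : degB n M v ≤ degB n B v :=
  Finset.card_le_card (Finset.filter_subset_filter _ h)

theorem degB_pos {v : ZMod n} {e : Sym2 (ZMod n)} (he : e ∈ B) (hv : v ∈ e) : 0 < degB n B v :=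
  Finset.card_pos.2 ⟨e, Finset.mem_filter.2 ⟨he, hv⟩⟩

theorem eq_of_degB_le_one {v : ZMod n} {e f : Sym2 (ZMod n)} (h : degB n B v ≤ 1) (he : e ∈ B)
    (hve : v ∈ e) (hf : f ∈ B) (hvf : v ∈ f) : e = f :=
  Finset.card_le_one.1 h e (Finset.mem_filter.2 ⟨he, hve⟩) f (Finset.mem_filter.2 ⟨hf, hvf⟩)

theorem eq_or_eq_of_degB_le_two {v : ZMod n} {e f g : Sym2 (ZMod n)} (h : degB n B v ≤ 2)
    (he : e ∈ B) (hve : v ∈ e) (hf : f ∈ B) (hvf : v ∈ f) (hg : g ∈ B) (hvg : v ∈ g)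
    (hef : e ≠ f) : g = e ∨ g = f := by
  by_contra! hne
  have : 2 < degB n B v := Finset.two_lt_card.2
    ⟨e, Finset.mem_filter.2 ⟨he, hve⟩, f, Finset.mem_filter.2 ⟨hf, hvf⟩, g,
      Finset.mem_filter.2 ⟨hg, hvg⟩, hef, hne.1.symm, hne.2.symm⟩
  omega

theorem IsEdgeOn.exists_other {v : ZMod n} {e : Sym2 (ZMod n)} (he : IsEdgeOn n S e)
    (hv : v ∈ e) : ∃ x ∈ S, x ≠ v ∧ e = s(v, x) := by
  obtain ⟨x, rfl⟩ := Sym2.mem_iff_exists.1 hv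
  rw [isEdgeOn_iff] at he
  exact ⟨x, he.2.1, he.2.2.symm, rfl⟩

theorem IsEdgeOn.of_erase {v : ZMod n} {e : Sym2 (ZMod n)} (he : IsEdgeOn n (S.erase v) e) :
    IsEdgeOn n S e := by
  obtain ⟨a, b, rfl, ha, hb, hab⟩ := he
  exact ⟨a, b, rfl, Finset.mem_of_mem_erase ha, Finset.mem_of_mem_erase hb, hab⟩

/-- The vertex `i` of the polygon on `S` is not covered by an ear-cover in `B`. -/
def Uncovered (S : Finset (ZMod n)) (B : Finset (Sym2 (ZMod n))) (i : ZMod n) : Prop :=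
  ∃ h j, Adj S h i ∧ Adj S i j ∧ h ≠ j ∧ s(h, j) ∉ B

variable [NeZero n]

theorem uncovered_iff {h i j : ZMod n} (h1 : Adj S h i) (h2 : Adj S i j) (hj : h ≠ j) :
    Uncovered S B i ↔ s(h, j) ∉ B := by
  refine ⟨?_, fun hB => ⟨h, j, h1, h2, hj, hB⟩⟩
  rintro ⟨h', j', h1', h2', hj', hB⟩
  rcases adj_unique h1.symm h2 h1'.symm hj with rfl | rfl <;>
    rcases adj_unique h1.symm h2 h2' hj with rfl | rfl
  · exact absurd rfl hj'
  · exact hB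
  · rwa [Sym2.eq_swap]
  · exact absurd rfl hj'

theorem Uncovered.of_del {i u : ZMod n} (hu : u ∈ S) (h : Uncovered (S.erase u) (del B u) i) :
    Uncovered S B i ∨ Adj S u i := by
  obtain ⟨x, y, hx, hy, hxy, hB⟩ := h
  rcases hx.of_erase hu with hx' | hx'
  · rcases hy.of_erase hu with hy' | hy'
    · refine Or.inl ⟨x, y, hx', hy', hxy, fun hB' => hB (mem_del.2 ⟨hB', ?_⟩)⟩
      rw [Sym2.mem_iff, not_or]
      exact ⟨(Finset.ne_of_mem_erase hx.1).symm, (Finset.ne_of_mem_erase hy.2.1).symm⟩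
    · exact Or.inr hy'.1.symm
  · exact Or.inr hx'.2

/-- Deleting an uncovered vertex from a blocker. -/
theorem IsBlockerOn.delete {i : ZMod n} (hB : IsBlockerOn n S B) (hi : Uncovered S B i)
    (hS : 4 ≤ S.card) : IsBlockerOn n (S.erase i) (del B i) := by
  refine ⟨fun e he => ?_, fun T hT => ?_⟩
  · rw [mem_del] at he
    obtain ⟨a, b, rfl, ha, hb, hab⟩ := hB.1 e he.1
    rw [Sym2.mem_iff, not_or] at he
    exact ⟨a, b, rfl, Finset.mem_erase.2 ⟨Ne.symm he.2.1, ha⟩,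
      Finset.mem_erase.2 ⟨Ne.symm he.2.2, hb⟩, hab⟩
  · obtain ⟨h, j, h1, h2, hj, hhj⟩ := hi
    obtain ⟨e, he⟩ := hB.2 _ (hT.insert_ear h1 h2 hj hS)
    rw [Finset.mem_inter, Finset.mem_insert] at he
    rcases he with ⟨he, rfl | heT⟩
    · exact absurd he hhj
    · exact ⟨e, Finset.mem_inter.2 ⟨mem_del.2 ⟨he, (hT.1 e heT).of_erase.2⟩, heT⟩⟩

/-- Inserting a vertex `w` next to `v` in a blocker. -/
theorem IsBlockerOn.of_contract {v w : ZMod n} (hM : IsBlockerOn n (S.erase w) M)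
    (hvw : Adj S v w) (hMB : M ⊆ B) (hBe : ∀ e ∈ B, IsEdgeOn n S e)
    (hx : ∀ T, IsTriangulationOn n S T → (∀ e ∈ B, e ∉ T) → ∀ x, s(v, x) ∈ M → s(w, x) ∉ T) :
    IsBlockerOn n S B := by
  refine ⟨hBe, fun T hT => ?_⟩
  by_contra hne
  have hdis : ∀ e ∈ B, e ∉ T := fun e he heT => hne ⟨e, Finset.mem_inter.2 ⟨he, heT⟩⟩
  obtain ⟨T', hT', h⟩ := hT.contract hvw
  obtain ⟨e, he⟩ := hM.2 T' hT'
  rw [Finset.mem_inter] at he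
  rcases h e he.2 with h | ⟨x, rfl, h⟩
  · exact hdis e (hMB he.1) h
  · exact hx T hT hdis x he.1 h

theorem IsBlockerOn.of_twin {v w j : ZMod n} (hM : IsBlockerOn n (S.erase w) M)
    (hvw : Adj S v w) (hMB : M ⊆ B) (hBe : ∀ e ∈ B, IsEdgeOn n S e) (hv : degB n M v ≤ 1)
    (hvj : s(v, j) ∈ M) (hwj : s(w, j) ∈ B) : IsBlockerOn n S B := by
  refine hM.of_contract hvw hMB hBe fun T _ hdis x hx => ?_
  have := eq_of_degB_le_one hv hvj (Sym2.mem_mk_left _ _) hx (Sym2.mem_mk_left _ _)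
  rw [Sym2.congr_right] at this
  exact this ▸ hdis _ hwj

theorem IsBlockerOn.four_le_card (hB : IsBlockerOn n S B) : 4 ≤ S.card := by
  by_contra hlt
  have hno : ∀ e, ¬ IsDiagonalOn n S e := by
    intro e he
    induction e using Sym2.ind with | _ a b
    rw [isDiagonalOn_iff] at he
    obtain ⟨ha, hb, ⟨c, hc, h1⟩, ⟨d, hd, h2⟩⟩ := he
    have hcd : c ≠ d := by
      rintro rfl
      rw [btw_iff] at h1 h2
      omega
    have : ({a, b, c, d} : Finset (ZMod n)).card = 4 := by
      obtain ⟨q1, q2, q3⟩ := h1.ne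
      obtain ⟨q4, q5, -⟩ := h2.ne
      simp [q1, q2.symm, q3, q4, q5.symm, hcd]
    have : ({a, b, c, d} : Finset (ZMod n)) ⊆ S := by
      intro x hx
      simp only [Finset.mem_insert, Finset.mem_singleton] at hx
      rcases hx with rfl | rfl | rfl | rfl <;> assumption
    have := Finset.card_le_card this
    omega
  obtain ⟨e, he⟩ := hB.2 ∅ ⟨by simp, by simp, fun e he => absurd he (hno e)⟩
  simp at he

theorem IsBlockerOn.exists_mem (hB : IsBlockerOn n S B) {v : ZMod n} (hv : v ∈ S) :
    ∃ e ∈ B, v ∈ e := by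
  induction hN : S.card generalizing S B with
  | zero => simp_all
  | succ N ih =>
    have h4 := hB.four_le_card
    by_contra! hno
    obtain ⟨p, -, hp, -, -⟩ := exists_nbrs hv (by omega)
    obtain ⟨q, hq, hvq⟩ := exists_adj_ne hp.symm (by omega)
    have hunc : Uncovered S B p :=
      ⟨v, q, hp.symm, hq, hvq, fun h => hno _ h (Sym2.mem_mk_left _ _)⟩
    obtain ⟨e, he, hve⟩ := ih (hB.delete hunc h4) (Finset.mem_erase.2 ⟨hp.2.2.1.symm, hv⟩)
      (by rw [Finset.card_erase_of_mem hp.1, hN]; rfl)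
    exact hno e (del_subset he) hve

theorem exists_uncovered (hlt : B.card < S.card) (hS : 5 ≤ S.card) : ∃ i, Uncovered S B i := by
  by_contra! hno
  have hex : ∀ i : ZMod n, ∃ e : Sym2 (ZMod n), i ∈ S → ∃ h j, Adj S h i ∧ Adj S i j ∧ h ≠ j ∧
      e = s(h, j) ∧ e ∈ B := by
    intro i
    by_cases hi : i ∈ S
    · obtain ⟨h, j, h1, h2, hj⟩ := exists_nbrs hi (by omega)
      refine ⟨s(h, j), fun _ => ⟨h, j, h1, h2, hj, rfl, ?_⟩⟩
      by_contra hB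
      exact hno i ⟨h, j, h1, h2, hj, hB⟩
    · exact ⟨s(i, i), fun h => absurd h hi⟩
  choose f hf using hex
  have hmap : ∀ i ∈ S, f i ∈ B := by
    intro i hi
    obtain ⟨-, -, -, -, -, -, h⟩ := hf i hi
    exact h
  obtain ⟨i, hi, i', hi', hne, heq⟩ := Finset.exists_ne_map_eq_of_card_lt_of_maps_to hlt hmap
  obtain ⟨h, j, h1, h2, hj, he, -⟩ := hf i hi
  obtain ⟨h', j', h1', h2', hj', he', -⟩ := hf i' hi'
  rw [he, he', Sym2.eq_iff] at heq
  rcases heq with ⟨rfl, rfl⟩ | ⟨rfl, rfl⟩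
  · exact ne_of_path_four h1 h2 h2'.symm h1'.symm hj hne hS rfl
  · exact ne_of_path_four h1 h2 h1' h2' hj hne hS rfl

theorem IsBlockerOn.not_uncovered (hB : IsBlockerOn n S B) (hS : S.card = 4) (i : ZMod n) :
    ¬ Uncovered S B i := by
  intro hi
  have h := (hB.delete hi hS.ge).four_le_card
  obtain ⟨_, _, h1, -⟩ := hi
  rw [Finset.card_erase_of_mem h1.2.1] at h
  omega

theorem IsBlockerOn.card_le (hB : IsBlockerOn n S B) : S.card ≤ B.card + 2 := by
  induction hN : S.card generalizing S B with
  | zero => omega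
  | succ N ih =>
    have h4 := hB.four_le_card
    rcases h4.eq_or_lt with h4' | h5
    · obtain ⟨i, hi⟩ : S.Nonempty := Finset.card_pos.1 (by omega)
      obtain ⟨h, j, h1, h2, hj⟩ := exists_nbrs hi (by omega)
      obtain ⟨k, hk, hik⟩ := exists_adj_ne h1.symm (by omega)
      have q1 := hB.not_uncovered h4'.symm i
      have q2 := hB.not_uncovered h4'.symm h
      rw [uncovered_iff h1 h2 hj, not_not] at q1
      rw [uncovered_iff h1.symm hk hik, not_not] at q2
      have : s(h, j) ≠ s(i, k) := by
        rw [Ne, Sym2.eq_iff]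
        rintro (⟨q, -⟩ | ⟨-, q⟩)
        · exact h1.2.2.1 q
        · exact h2.2.2.1 q.symm
      have : 1 < B.card := Finset.one_lt_card.2 ⟨_, q1, _, q2, this⟩
      omega
    · by_contra hlt
      obtain ⟨i, hi⟩ := exists_uncovered (S := S) (B := B) (by omega) h5
      have hiS : i ∈ S := by
        obtain ⟨_, _, h, -⟩ := hi
        exact h.2.1
      have hc : (S.erase i).card = N := by rw [Finset.card_erase_of_mem hiS, hN]; rfl
      have := ih (hB.delete hi h4) hc
      obtain ⟨e, he, hie⟩ := hB.exists_mem hiS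
      have := degB_pos he hie
      have := degB_add_card_del B i
      omega

theorem IsBlockerOn.degB_le {i : ZMod n} (hB : IsBlockerOn n S B) (hi : Uncovered S B i) :
    S.card + degB n B i ≤ B.card + 3 := by
  have h4 := hB.four_le_card
  have h := (hB.delete hi h4).card_le
  obtain ⟨_, _, h1, -⟩ := hi
  rw [Finset.card_erase_of_mem h1.2.1] at h
  have := degB_add_card_del B i
  omega

theorem IsBlockerOn.one_lt_degB {x y : ZMod n} (hB : IsBlockerOn n S B) (hx : x ∈ S)
    (hxy : x ≠ y) (hxyB : s(x, y) ∈ B) (hy : Uncovered S B y) : 1 < degB n B x := by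
  by_contra! hdeg
  obtain ⟨e, he, hxe⟩ := (hB.delete hy hB.four_le_card).exists_mem (Finset.mem_erase.2 ⟨hxy, hx⟩)
  rw [mem_del] at he
  have := eq_of_degB_le_one hdeg hxyB (Sym2.mem_mk_left _ _) he.1 hxe
  exact he.2 (this ▸ Sym2.mem_mk_right _ _)

theorem exists_adj_of_mem_of_not_mem {P : ZMod n → Prop} {i j : ZMod n} (hi : i ∈ S) (hPi : P i)
    (hj : j ∈ S) (hPj : ¬ P j) : ∃ u p, Adj S u p ∧ P u ∧ ¬ P p := by
  classical
  obtain ⟨u, hu, hmax⟩ := Finset.exists_max_image (S.filter P) (fun u => (u - j).val)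
    ⟨i, Finset.mem_filter.2 ⟨hi, hPi⟩⟩
  rw [Finset.mem_filter] at hu
  have huj : u ≠ j := by
    rintro rfl
    exact hPj hu.2
  obtain ⟨p, hp, hup, hno⟩ := exists_next hu.1 (Finset.one_lt_card.2 ⟨u, hu.1, j, hj, huj⟩)
  refine ⟨u, p, ⟨hu.1, hp, hup, Or.inl hno⟩, hu.2, fun hPp => ?_⟩
  have hpj : j ≠ p := by
    rintro rfl
    exact hPj hPp
  have h1 : Btw n j u p := (Btw.of_not (hno j hj) huj hpj hup).rotate
  exact absurd h1.2 (not_lt.2 (hmax p (Finset.mem_filter.2 ⟨hp, hPp⟩)))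

end Blockers

section Erasable

variable {n : ℕ} [NeZero n] {S : Finset (ZMod n)} {B M : Finset (Sym2 (ZMod n))}

theorem IsBlockerOn.exists_erase_of_card_eq_four (hB : IsBlockerOn n S B) (hS : S.card = 4)
    (hcard : B.card = 3) : ∃ e ∈ B, IsBlockerOn n S (B.erase e) := by
  obtain ⟨i, hi⟩ : S.Nonempty := Finset.card_pos.1 (by omega)
  obtain ⟨h, j, h1, h2, hj⟩ := exists_nbrs hi (by omega)
  obtain ⟨k, hk, hik⟩ := exists_adj_ne h1.symm (by omega)
  have q1 := hB.not_uncovered hS i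
  have q2 := hB.not_uncovered hS h
  rw [uncovered_iff h1 h2 hj, not_not] at q1
  rw [uncovered_iff h1.symm hk hik, not_not] at q2
  have hkj : k ≠ j := ne_of_path_three hk.symm h1 h2 hik.symm hS.ge
  obtain ⟨e, he, he1, he2⟩ := exists_third (S := B) (a := s(h, j)) (b := s(i, k)) hcard.ge
  refine ⟨e, he, fun f hf => hB.1 f (Finset.mem_of_mem_erase hf), fun T hT => ?_⟩
  by_cases hT1 : s(h, j) ∈ T
  · exact ⟨_, Finset.mem_inter.2 ⟨Finset.mem_erase.2 ⟨he1.symm, q1⟩, hT1⟩⟩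
  obtain ⟨f, hf, hcr⟩ := hT.2.2 _ (isDiagonalOn_skip h1 h2 hj hS.ge) hT1
  have hfd := hT.1 f hf
  have hif : i ∈ f := by
    induction f using Sym2.ind with | _ p q
    rw [isDiagonalOn_iff] at hfd
    rw [Sym2.mem_iff]
    exact (eq_or_eq_of_cross_ear h1 h2 hj hfd.1 hfd.2.1 hcr.symm).imp Eq.symm Eq.symm
  obtain ⟨x, rfl⟩ := Sym2.mem_iff_exists.1 hif
  have hx := ((isDiagonalOn_iff _ _ _).1 hfd).2.1
  have hne : x ≠ i ∧ x ≠ h ∧ x ≠ j := by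
    simp only [cross_iff, btw_iff] at hcr
    refine ⟨?_, ?_, ?_⟩ <;> rintro rfl <;> omega
  have hxk : x = k := by
    have hc : (((S.erase i).erase h).erase j).card ≤ 1 := by
      rw [Finset.card_erase_of_mem, Finset.card_erase_of_mem, Finset.card_erase_of_mem hi, hS]
      · exact Finset.mem_erase.2 ⟨h1.2.2.1, h1.1⟩
      · exact Finset.mem_erase.2 ⟨hj.symm, Finset.mem_erase.2 ⟨h2.2.2.1.symm, h2.2.1⟩⟩
    refine Finset.card_le_one.1 hc x ?_ k ?_
    · simp only [Finset.mem_erase]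
      exact ⟨hne.2.2, hne.2.1, hne.1, hx⟩
    · simp only [Finset.mem_erase]
      exact ⟨hkj, hk.2.2.1.symm, hik.symm, hk.2.1⟩
  subst hxk
  exact ⟨_, Finset.mem_inter.2 ⟨Finset.mem_erase.2 ⟨he2.symm, q2⟩, hf⟩⟩

/-- Inserting the vertex `u` at the end of the path `a, b, p, u` in a blocker in which `p` is
only joined to `a`. -/
theorem IsBlockerOn.of_path {a b p u : ZMod n} (hM : IsBlockerOn n (S.erase u) M)
    (hab : Adj S a b) (hbp : Adj S b p) (hpu : Adj S p u) (hap : a ≠ p) (hbu : b ≠ u)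
    (hMB : M ⊆ B) (hBe : ∀ e ∈ B, IsEdgeOn n S e) (hS : 4 ≤ S.card) (hbuB : s(b, u) ∈ B)
    (hapB : s(a, p) ∈ B) (hp : ∀ f ∈ M, p ∈ f → f = s(p, a)) : IsBlockerOn n S B := by
  refine hM.of_contract hpu hMB hBe fun T hT hdis x hx hxT => ?_
  have := hp _ hx (Sym2.mem_mk_left _ _)
  rw [Sym2.congr_right] at this
  subst this
  rw [Sym2.eq_swap] at hxT
  rcases hT.quad hab hbp hpu hap hbu hS hxT with h | h
  · exact hdis _ hapB h
  · exact hdis _ hbuB h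

/-- A blocker with one edge more than the minimum in which every uncovered vertex has degree one
is not saturated. -/
theorem IsBlockerOn.exists_erase (hB : IsBlockerOn n S B) (hcard : B.card + 1 = S.card)
    (hdeg : ∀ i, Uncovered S B i → degB n B i ≤ 1) : ∃ e ∈ B, IsBlockerOn n S (B.erase e) := by
  induction hN : S.card generalizing S B with
  | zero => omega
  | succ N ih =>
    have h4 := hB.four_le_card
    rcases h4.eq_or_lt with h4' | h5
    · exact hB.exists_erase_of_card_eq_four h4'.symm (by omega)
    have h5 : 5 ≤ S.card := h5
    obtain ⟨u, p, hup, hu, hp⟩ : ∃ u p, Adj S u p ∧ Uncovered S B u ∧ ¬ Uncovered S B p := by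
      obtain ⟨i, hi⟩ := exists_uncovered (S := S) (B := B) (by omega) h5
      have hiS : i ∈ S := by
        obtain ⟨_, _, h, -⟩ := hi
        exact h.2.1
      obtain ⟨e, he, hie⟩ := hB.exists_mem hiS
      obtain ⟨j, hj, hji, rfl⟩ := (hB.1 e he).exists_other hie
      exact exists_adj_of_mem_of_not_mem hiS hi hj fun hj' =>
        absurd (hB.one_lt_degB hiS hji.symm he hj') (not_lt.2 (hdeg i hi))
    obtain ⟨w, huw, hpw⟩ := exists_adj_ne hup.symm (by omega)
    obtain ⟨b, hpb, hub⟩ := exists_adj_ne hup (by omega)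
    obtain ⟨a, hba, hpa⟩ := exists_adj_ne hpb (by omega)
    have hau : a ≠ u := ne_of_path_three hba.symm hpb.symm hup.symm hpa.symm h4
    have hbw : b ≠ w := ne_of_path_three hpb.symm hup.symm huw hub.symm h4
    have haw : a ≠ w := ne_of_path_four hba.symm hpb.symm hup.symm huw hpa.symm hub.symm h5
    have hubB : s(u, b) ∈ B := by
      rwa [uncovered_iff hup hpb hub, not_not] at hp
    have hu1 := hdeg u hu
    have huniq : ∀ f ∈ B, u ∈ f → f = s(u, b) := fun f hf huf =>
      eq_of_degB_le_one hu1 hf huf hubB (Sym2.mem_mk_left _ _)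
    have hb : ¬ Uncovered S B b := fun hb =>
      absurd (hB.one_lt_degB huw.1 hub hubB hb) (not_lt.2 hu1)
    have hpaB : s(p, a) ∈ B := by
      rwa [uncovered_iff hpb hba hpa, not_not] at hb
    have hw : Uncovered S B w := by
      obtain ⟨t, hwt, hut⟩ := exists_adj_ne huw (by omega)
      refine ⟨u, t, huw, hwt, hut, fun h => ?_⟩
      have := huniq _ h (Sym2.mem_mk_left _ _)
      rw [Sym2.congr_right] at this
      exact ne_of_path_four hpb.symm hup.symm huw hwt hub.symm hpw h5 this.symm
    have hw1 := hdeg w hw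
    have hB0 := hB.delete hu h4
    have hS0 : (S.erase u).card = N := by rw [Finset.card_erase_of_mem huw.1, hN]; rfl
    have hB0card : (del B u).card + 1 = N := by
      have := degB_add_card_del B u
      have := degB_pos hubB (Sym2.mem_mk_left _ _)
      omega
    have hpb0 : Adj (S.erase u) p b := hpb.erase hup.2.2.1.symm hub.symm
    have hba0 : Adj (S.erase u) b a := hba.erase hub.symm hau
    have hpw0 : Adj (S.erase u) p w := hup.symm.erase_skip huw hpw
    have hdeg0 : (Uncovered (S.erase u) (del B u) p → degB n (del B u) p ≤ 1) →
        ∀ i, Uncovered (S.erase u) (del B u) i → degB n (del B u) i ≤ 1 := by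
      intro hp i hi
      rcases hi.of_del huw.1 with h | h
      · exact (degB_mono del_subset i).trans (hdeg i h)
      · rcases adj_unique hup huw h hpw with rfl | rfl
        · exact hp hi
        · exact (degB_mono del_subset _).trans hw1
    have hsub : ∀ e, (del B u).erase e ⊆ B.erase e := fun e =>
      Finset.erase_subset_erase _ del_subset
    have hne : ∀ e ∈ del B u, ∀ x, s(u, x) ≠ e := by
      rintro e he x rfl
      exact (mem_del.1 he).2 (Sym2.mem_mk_left _ _)
    have hBe : ∀ e, ∀ f ∈ B.erase e, IsEdgeOn n S f := fun e f hf =>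
      hB.1 f (Finset.mem_of_mem_erase hf)
    by_cases hwb : s(w, b) ∈ B
    · have hwb0 : s(b, w) ∈ del B u := by
        rw [Sym2.eq_swap, mem_del, Sym2.mem_iff, not_or]
        exact ⟨hwb, huw.2.2.1, hub⟩
      obtain ⟨e, he, heB⟩ := ih hB0 (by omega) (hdeg0 fun h =>
        absurd hwb0 ((uncovered_iff hpb0.symm hpw0 hbw).1 h)) hS0
      refine ⟨e, del_subset he, ?_⟩
      refine heB.of_twin (v := w) (j := b) huw.symm (hsub e) (hBe e)
        ((degB_mono ((Finset.erase_subset _ _).trans del_subset) w).trans hw1) ?_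
        (Finset.mem_erase.2 ⟨hne e he b, hubB⟩)
      obtain ⟨f, hf, hwf⟩ := heB.exists_mem hpw0.2.1
      rwa [eq_of_degB_le_one hw1 hwb (Sym2.mem_mk_left _ _)
        (Finset.mem_of_mem_erase (hsub e hf)) hwf]
    have hp0 : Uncovered (S.erase u) (del B u) p :=
      (uncovered_iff hpb0.symm hpw0 hbw).2 fun h =>
        hwb (by rw [Sym2.eq_swap]; exact del_subset h)
    have hp2 : degB n (del B u) p ≤ 2 := by
      have := hB0.degB_le hp0
      omega
    have hpa0 : s(p, a) ∈ del B u := by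
      rw [mem_del, Sym2.mem_iff, not_or]
      exact ⟨hpaB, hup.2.2.1, hau.symm⟩
    have hfinal : ∀ e ∈ del B u, IsBlockerOn n (S.erase u) ((del B u).erase e) →
        (∀ f ∈ (del B u).erase e, p ∈ f → f = s(p, a)) → IsBlockerOn n S (B.erase e) := by
      intro e he heB hpe
      refine heB.of_path hba.symm hpb.symm hup.symm hpa.symm hub.symm (hsub e) (hBe e) h4 ?_ ?_ hpe
      · rw [Sym2.eq_swap]
        exact Finset.mem_erase.2 ⟨hne e he b, hubB⟩
      · obtain ⟨f, hf, hpf⟩ := heB.exists_mem hpw0.1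
        rw [Sym2.eq_swap, ← hpe f hf hpf]
        exact hsub e hf
    by_cases hall : ∀ f ∈ del B u, p ∈ f → f = s(p, a)
    · obtain ⟨e, he, heB⟩ := ih hB0 (by omega) (hdeg0 fun _ =>
          Finset.card_le_one.2 fun f hf g hg => by
        rw [Finset.mem_filter] at hf hg
        rw [hall f hf.1 hf.2, hall g hg.1 hg.2]) hS0
      exact ⟨e, del_subset he, hfinal e he heB fun f hf => hall f (Finset.mem_of_mem_erase hf)⟩
    push Not at hall
    obtain ⟨f, hf, hpf, hfa⟩ := hall
    have hother : ∀ g ∈ (del B u).erase f, p ∈ g → g = s(p, a) := by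
      intro g hg hpg
      rw [Finset.mem_erase] at hg
      exact (eq_or_eq_of_degB_le_two hp2 hf hpf hpa0 (Sym2.mem_mk_left _ _) hg.2 hpg
        hfa).resolve_left
        hg.1
    refine ⟨f, del_subset hf, hfinal f hf ?_ hother⟩
    have hM := hB0.delete hp0 hB0.four_le_card
    set M := del (del B u) p with hMdef
    have hS1 : ((S.erase u).erase p).card + 1 = N := by
      have := hM.four_le_card
      rw [Finset.card_erase_of_mem hpw0.1] at this ⊢
      omega
    have hMcard : M.card + 3 ≤ N := by
      have h1 := degB_add_card_del (del B u) p
      rw [← hMdef] at h1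
      have h2 : 1 < degB n (del B u) p := Finset.one_lt_card.2
        ⟨f, Finset.mem_filter.2 ⟨hf, hpf⟩, _, Finset.mem_filter.2 ⟨hpa0, Sym2.mem_mk_left _ _⟩, hfa⟩
      omega
    have hMB0 : M ⊆ (del B u).erase f := fun g hg => by
      rw [hMdef, mem_del] at hg
      refine Finset.mem_erase.2 ⟨?_, hg.1⟩
      rintro rfl
      exact hg.2 hpf
    have hMB : M ⊆ B := hMB0.trans ((Finset.erase_subset _ _).trans del_subset)
    have hpaf : s(p, a) ∈ (del B u).erase f := Finset.mem_erase.2 ⟨hfa.symm, hpa0⟩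
    have hB0e : ∀ g ∈ (del B u).erase f, IsEdgeOn n (S.erase u) g := fun g hg =>
      hB0.1 g (Finset.mem_of_mem_erase hg)
    by_cases hwa : s(w, a) ∈ B
    · refine hM.of_twin (v := w) (j := a) hpw0.symm hMB0 hB0e ((degB_mono hMB w).trans hw1) ?_ hpaf
      obtain ⟨g, hg, hwg⟩ := hM.exists_mem (v := w)
        (Finset.mem_erase.2 ⟨hpw.symm, hpw0.2.1⟩)
      rwa [eq_of_degB_le_one hw1 hwa (Sym2.mem_mk_left _ _) (hMB hg) hwg]
    have hb1 : Uncovered ((S.erase u).erase p) M b :=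
      (uncovered_iff (hba0.symm.erase hpa.symm hpb.2.2.1.symm)
        (hpb0.symm.erase_skip hpw0 hbw) haw).2 fun h => hwa (by
          rw [Sym2.eq_swap]
          exact hMB h)
    have hbdeg : degB n M b ≤ 1 := by
      have := hM.degB_le hb1
      omega
    obtain ⟨z, haz, hbz⟩ := exists_adj_ne hba (by omega)
    have hzp : z ≠ p := ne_of_path_three haz.symm hba.symm hpb.symm hbz.symm h4
    have hzu : z ≠ u := ne_of_path_four haz.symm hba.symm hpb.symm hup.symm hbz.symm hpa.symm h5
    by_cases hbzB : s(b, z) ∈ B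
    · have hbzM : s(b, z) ∈ M := by
        rw [hMdef, mem_del, mem_del, Sym2.mem_iff, Sym2.mem_iff, not_or, not_or]
        exact ⟨⟨hbzB, hub, hzu.symm⟩, hpb.2.2.1, hzp.symm⟩
      refine hM.of_path (haz.symm.erase hzu hau) hba0.symm hpb0.symm hbz.symm hpa.symm hMB0 hB0e
        hB0.four_le_card ?_ ?_ fun g hg hbg => eq_of_degB_le_one hbdeg hg hbg hbzM
          (Sym2.mem_mk_left _ _)
      · rwa [Sym2.eq_swap]
      · rw [Sym2.eq_swap]
        exact hMB0 hbzM
    · exfalso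
      have ha1 := hdeg a ⟨b, z, hba, haz, hbz, hbzB⟩
      obtain ⟨g, hg, hag⟩ := hM.exists_mem (v := a)
        (Finset.mem_erase.2 ⟨hpa.symm, hba0.2.1⟩)
      have := eq_of_degB_le_one ha1 hpaB (Sym2.mem_mk_right _ _) (hMB hg) hag
      subst this
      exact (mem_del.1 hg).2 (Sym2.mem_mk_left _ _)

end Erasable

section Stability

variable {n : ℕ} {S : Finset (ZMod n)} {B : Finset (Sym2 (ZMod n))}

theorem IsBlockerOn.swap {A R : Finset (Sym2 (ZMod n))} (hB : IsBlockerOn n S B)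
    (hA : ∀ e ∈ A, IsEdgeOn n S e)
    (hR : ∀ T, IsTriangulationOn n S T → ∀ e ∈ R, e ∈ T → ∃ f ∈ (B \ R) ∪ A, f ∈ T) :
    IsBlockerOn n S ((B \ R) ∪ A) := by
  refine ⟨fun e he => ?_, fun T hT => ?_⟩
  · rcases Finset.mem_union.1 he with he | he
    · exact hB.1 e (Finset.mem_sdiff.1 he).1
    · exact hA e he
  · obtain ⟨e, he⟩ := hB.2 T hT
    rw [Finset.mem_inter] at he
    by_cases heR : e ∈ R
    · obtain ⟨f, hf, hfT⟩ := hR T hT e heR he.2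
      exact ⟨f, Finset.mem_inter.2 ⟨hf, hfT⟩⟩
    · exact ⟨e, Finset.mem_inter.2
        ⟨Finset.mem_union_left _ (Finset.mem_sdiff.2 ⟨he.1, heR⟩), he.2⟩⟩

variable [NeZero n]

/-- `B` is within distance five of a smallest blocker of the polygon on `S`. -/
def NearMinimal (S : Finset (ZMod n)) (B : Finset (Sym2 (ZMod n))) : Prop :=
  ∃ B', IsBlockerOn n S B' ∧ B'.card + 2 = S.card ∧ (symmDiff B B').card ≤ 5

theorem NearMinimal.of_swap {A R : Finset (Sym2 (ZMod n))} (hcard : B.card + 1 = S.card)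
    (hR : R ⊆ B) (hA : A.card < R.card) (hsum : A.card + R.card ≤ 5)
    (hblock : IsBlockerOn n S ((B \ R) ∪ A)) : NearMinimal S B := by
  refine ⟨_, hblock, ?_, ?_⟩
  · have h1 := hblock.card_le
    have h2 := Finset.card_union_le (B \ R) A
    have h3 := Finset.card_sdiff_add_card_eq_card hR
    omega
  · have : symmDiff B ((B \ R) ∪ A) ⊆ A ∪ R := by
      intro e he
      simp only [Finset.mem_symmDiff, Finset.mem_union, Finset.mem_sdiff] at he ⊢
      tauto
    exact (Finset.card_le_card this).trans ((Finset.card_union_le _ _).trans hsum)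

theorem IsBlockerOn.degB_del_le_one {u v : ZMod n} (hB : IsBlockerOn n S B)
    (hcard : B.card + 1 = S.card) (hu : Uncovered S B u) (h2 : 1 < degB n B u)
    (hv : Uncovered (S.erase u) (del B u) v) : degB n (del B u) v ≤ 1 := by
  have h4 := hB.four_le_card
  have h := (hB.delete hu h4).degB_le hv
  have := degB_add_card_del B u
  obtain ⟨_, _, h1, -⟩ := hu
  rw [Finset.card_erase_of_mem h1.2.1] at h
  omega

theorem NearMinimal.of_twin {u v : ZMod n} (hB : IsBlockerOn n S B)
    (hcard : B.card + 1 = S.card) (hu : Uncovered S B u) (h2 : 1 < degB n B u)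
    (hvu : Adj S v u) (hv : degB n (del B u) v ≤ 1) : NearMinimal S B := by
  have hM := hB.delete hu hB.four_le_card
  obtain ⟨e, he, hve⟩ := hM.exists_mem (Finset.mem_erase.2 ⟨hvu.2.2.1, hvu.1⟩)
  obtain ⟨j, hj, -, rfl⟩ := (hM.1 e he).exists_other hve
  rw [Finset.mem_erase] at hj
  have hdeg : degB n B u = (B.filter fun e => u ∈ e).card := rfl
  have hle := hB.degB_le hu
  have hsd : B \ (B.filter fun e => u ∈ e) = del B u := by
    ext e
    simp only [Finset.mem_sdiff, Finset.mem_filter, mem_del]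
    tauto
  refine NearMinimal.of_swap (A := {s(u, j)}) (R := B.filter fun e => u ∈ e) hcard
    (Finset.filter_subset _ _) (by rw [Finset.card_singleton]; omega)
    (by rw [Finset.card_singleton]; omega) ?_
  rw [hsd]
  refine hM.of_twin hvu Finset.subset_union_left ?_ hv he
    (Finset.mem_union_right _ (Finset.mem_singleton_self _))
  intro e he
  rcases Finset.mem_union.1 he with he | he
  · exact (hM.1 e he).of_erase
  · rw [Finset.mem_singleton.1 he, isEdgeOn_iff]
    exact ⟨hvu.2.1, hj.2, hj.1.symm⟩

theorem NearMinimal.of_uncovered {u v : ZMod n} (hB : IsBlockerOn n S B)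
    (hcard : B.card + 1 = S.card) (hu : Uncovered S B u) (h2 : 1 < degB n B u)
    (hvu : Adj S v u) (hv : Uncovered (S.erase u) (del B u) v) : NearMinimal S B :=
  .of_twin hB hcard hu h2 hvu (hB.degB_del_le_one hcard hu h2 hv)

theorem NearMinimal.of_path {x₂ x₁ u y₁ y₂ : ZMod n} (hB : IsBlockerOn n S B)
    (hcard : B.card + 1 = S.card) (hS : 6 ≤ S.card) (hu : Uncovered S B u)
    (h2 : 1 < degB n B u) (hx₁ : 1 < degB n B x₁) (h21 : Adj S x₂ x₁) (h1u : Adj S x₁ u)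
    (hu1 : Adj S u y₁) (h12 : Adj S y₁ y₂) (hxu : x₂ ≠ u) (hxy : x₁ ≠ y₁) (huy : u ≠ y₂)
    (hxyB : s(x₂, y₁) ∈ B) (hyxB : s(x₁, y₂) ∈ B) (huyB : s(u, y₂) ∈ B) :
    NearMinimal S B := by
  have h4 := hB.four_le_card
  have h5 : 5 ≤ S.card := by omega
  have n1 := h21.2.2.1
  have n2 := h1u.2.2.1
  have n3 := hu1.2.2.1
  have n4 := h12.2.2.1
  have n5 : x₂ ≠ y₁ := ne_of_path_three h21 h1u hu1 hxu h4
  have n6 : x₁ ≠ y₂ := ne_of_path_three h1u hu1 h12 hxy h4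
  have n7 : x₂ ≠ y₂ := ne_of_path_four h21 h1u hu1 h12 hxu hxy h5
  by_cases hux : s(x₂, u) ∈ B
  · have hR : ({s(x₂, y₁), s(x₁, y₂)} : Finset (Sym2 (ZMod n))).card = 2 := by
      apply Finset.card_pair
      rw [Ne, Sym2.eq_iff]
      grind
    refine .of_swap (A := {s(x₁, y₁)}) (R := {s(x₂, y₁), s(x₁, y₂)}) hcard ?_
      (by rw [hR, Finset.card_singleton]; omega)
      (by rw [hR, Finset.card_singleton]; omega) (hB.swap ?_ ?_)
    · simp [Finset.insert_subset_iff, hxyB, hyxB]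
    · simp [isEdgeOn_iff, h1u.1, hu1.2.1, hxy]
    · have m1 : s(x₁, y₁) ∈ (B \ {s(x₂, y₁), s(x₁, y₂)}) ∪ {s(x₁, y₁)} := by simp
      have m2 : s(x₂, u) ∈ (B \ {s(x₂, y₁), s(x₁, y₂)}) ∪ {s(x₁, y₁)} := by
        simp only [Finset.mem_union, Finset.mem_sdiff, Finset.mem_insert, Finset.mem_singleton,
          Sym2.eq_iff]
        grind
      have m3 : s(u, y₂) ∈ (B \ {s(x₂, y₁), s(x₁, y₂)}) ∪ {s(x₁, y₁)} := by
        simp only [Finset.mem_union, Finset.mem_sdiff, Finset.mem_insert, Finset.mem_singleton,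
          Sym2.eq_iff]
        grind
      intro T hT e he heT
      rw [Finset.mem_insert, Finset.mem_singleton] at he
      rcases he with rfl | rfl
      · rcases hT.quad h21 h1u hu1 hxu hxy h4 heT with h | h
        · exact ⟨_, m2, h⟩
        · exact ⟨_, m1, h⟩
      · rcases hT.quad h1u hu1 h12 hxy huy h4 heT with h | h
        · exact ⟨_, m1, h⟩
        · exact ⟨_, m3, h⟩
  have hx₁u : Uncovered S B x₁ := ⟨x₂, u, h21, h1u, hxu, hux⟩
  obtain ⟨x₃, h23, hx₁₃⟩ := exists_adj_ne h21.symm (by omega)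
  have n8 := h23.2.2.1
  have n9 : x₃ ≠ u := ne_of_path_three h23.symm h21 h1u hx₁₃.symm h4
  have n10 : x₃ ≠ y₁ := ne_of_path_four h23.symm h21 h1u hu1 hx₁₃.symm hxu h5
  have n11 : x₃ ≠ y₂ := ne_of_path_five h23.symm h21 h1u hu1 h12 hx₁₃.symm hxu hxy hS
  by_cases hx₃u : s(x₃, u) ∈ B
  swap
  · exact .of_uncovered hB hcard hx₁u hx₁ h21 ((uncovered_iff (h23.symm.erase hx₁₃.symm n1)
      (h21.erase_skip h1u hxu) n9).2 fun h => hx₃u (del_subset h))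
  have hx₃₁ : s(x₃, x₁) ∈ B := by
    by_contra hno
    have hx₂deg : degB n (del B u) x₂ ≤ 1 := hB.degB_del_le_one hcard hu h2
      ((uncovered_iff (h23.symm.erase n9 hxu) (h21.erase hxu n2) hx₁₃.symm).2
        fun h => hno (del_subset h))
    obtain ⟨x₄, h34, hx₂₄⟩ := exists_adj_ne h23 (by omega)
    have k1 : x₄ ≠ x₁ := ne_of_path_three h34.symm h23.symm h21 hx₂₄.symm h4
    have k2 : x₄ ≠ u := ne_of_path_four h34.symm h23.symm h21 h1u hx₂₄.symm hx₁₃.symm h5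
    have k3 : x₄ ≠ y₁ :=
      ne_of_path_five h34.symm h23.symm h21 h1u hu1 hx₂₄.symm hx₁₃.symm hxu hS
    have hx₂₄B : s(x₂, x₄) ∉ B := by
      intro h
      have := eq_of_degB_le_one (e := s(x₂, x₄)) (f := s(x₂, y₁)) hx₂deg
        (mem_del.2 ⟨h, by rw [Sym2.mem_iff]; grind⟩) (Sym2.mem_mk_left _ _)
        (mem_del.2 ⟨hxyB, by rw [Sym2.mem_iff]; grind⟩) (Sym2.mem_mk_left _ _)
      rw [Sym2.congr_right] at this
      exact k3 this
    have d1 : degB n (del B u) x₃ ≤ 1 := hB.degB_del_le_one hcard hu h2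
      ⟨x₂, x₄, h23.erase hxu n9, h34.erase n9 k2, hx₂₄, fun h => hx₂₄B (del_subset h)⟩
    have d2 : degB n (del B x₁) x₃ ≤ 1 := hB.degB_del_le_one hcard hx₁u hx₁
      ⟨x₂, x₄, h23.erase n1 hx₁₃.symm, h34.erase hx₁₃.symm k1, hx₂₄,
        fun h => hx₂₄B (del_subset h)⟩
    obtain ⟨g, hg, hx₃g⟩ := (hB.delete hu h4).exists_mem (Finset.mem_erase.2 ⟨n9, h34.1⟩)
    rw [mem_del] at hg
    by_cases hx₁g : x₁ ∈ g
    · rw [(Sym2.mem_and_mem_iff hx₁₃.symm).1 ⟨hx₃g, hx₁g⟩] at hg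
      exact hno hg.1
    · have := eq_of_degB_le_one d2 (mem_del.2 ⟨hg.1, hx₁g⟩) hx₃g
        (mem_del.2 ⟨hx₃u, by rw [Sym2.mem_iff]; grind⟩) (Sym2.mem_mk_left _ _)
      exact hg.2 (this ▸ Sym2.mem_mk_right _ _)
  have hR : ({s(x₂, y₁), s(x₁, y₂), s(x₃, u)} : Finset (Sym2 (ZMod n))).card = 3 := by
    rw [Finset.card_eq_three]
    refine ⟨_, _, _, ?_, ?_, ?_, rfl⟩ <;> rw [Ne, Sym2.eq_iff] <;> grind
  have hA : ({s(x₂, u), s(x₁, y₁)} : Finset (Sym2 (ZMod n))).card ≤ 2 := Finset.card_le_two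
  refine .of_swap (A := {s(x₂, u), s(x₁, y₁)}) (R := {s(x₂, y₁), s(x₁, y₂), s(x₃, u)}) hcard ?_
    (by omega) (by omega) (hB.swap ?_ ?_)
  · simp [Finset.insert_subset_iff, hxyB, hyxB, hx₃u]
  · simp [isEdgeOn_iff, h1u.1, hu1.2.1, hxy, h21.1, hu1.1, hxu]
  · have m1 : s(x₁, y₁) ∈ (B \ {s(x₂, y₁), s(x₁, y₂), s(x₃, u)}) ∪ {s(x₂, u), s(x₁, y₁)} := by
      simp
    have m2 : s(x₂, u) ∈ (B \ {s(x₂, y₁), s(x₁, y₂), s(x₃, u)}) ∪ {s(x₂, u), s(x₁, y₁)} := by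
      simp
    have m3 : s(u, y₂) ∈ (B \ {s(x₂, y₁), s(x₁, y₂), s(x₃, u)}) ∪ {s(x₂, u), s(x₁, y₁)} := by
      simp only [Finset.mem_union, Finset.mem_sdiff, Finset.mem_insert, Finset.mem_singleton,
        Sym2.eq_iff]
      grind
    have m4 : s(x₃, x₁) ∈ (B \ {s(x₂, y₁), s(x₁, y₂), s(x₃, u)}) ∪ {s(x₂, u), s(x₁, y₁)} := by
      simp only [Finset.mem_union, Finset.mem_sdiff, Finset.mem_insert, Finset.mem_singleton,
        Sym2.eq_iff]
      grind
    intro T hT e he heT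
    rw [Finset.mem_insert, Finset.mem_insert, Finset.mem_singleton] at he
    rcases he with rfl | rfl | rfl
    · rcases hT.quad h21 h1u hu1 hxu hxy h4 heT with h | h
      · exact ⟨_, m2, h⟩
      · exact ⟨_, m1, h⟩
    · rcases hT.quad h1u hu1 h12 hxy huy h4 heT with h | h
      · exact ⟨_, m1, h⟩
      · exact ⟨_, m3, h⟩
    · rcases hT.quad h23.symm h21 h1u hx₁₃.symm hxu h4 heT with h | h
      · exact ⟨_, m4, h⟩
      · exact ⟨_, m2, h⟩

theorem IsBlockerOn.nearMinimal {u : ZMod n} (hB : IsBlockerOn n S B)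
    (hcard : B.card + 1 = S.card) (hS : 6 ≤ S.card) (hu : Uncovered S B u)
    (h2 : 1 < degB n B u) : NearMinimal S B := by
  by_contra hnear
  have h4 := hB.four_le_card
  obtain ⟨x₁, y₁, h1u, hu1, hxy, hxyB⟩ := hu
  have hu : Uncovered S B u := ⟨x₁, y₁, h1u, hu1, hxy, hxyB⟩
  obtain ⟨x₂, h12, hux⟩ := exists_adj_ne h1u.symm (by omega)
  obtain ⟨y₂, h12', huy⟩ := exists_adj_ne hu1 (by omega)
  have n1 : x₂ ≠ y₁ := ne_of_path_three h12.symm h1u hu1 hux.symm h4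
  have n2 : x₁ ≠ y₂ := ne_of_path_three h1u hu1 h12' hxy h4
  have hskip : Adj (S.erase u) x₁ y₁ := h1u.erase_skip hu1 hxy
  have hB1 : s(x₂, y₁) ∈ B := by
    by_contra h
    exact hnear (.of_uncovered hB hcard hu h2 h1u ((uncovered_iff
      (h12.symm.erase hux.symm h1u.2.2.1) hskip n1).2 fun h' => h (del_subset h')))
  have hB2 : s(x₁, y₂) ∈ B := by
    by_contra h
    exact hnear (.of_uncovered hB hcard hu h2 hu1.symm ((uncovered_iff hskip
      (h12'.erase hu1.2.2.1.symm huy.symm) n2).2 fun h' => h (del_subset h')))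
  have dx : 1 < degB n (del B u) x₁ := by
    by_contra! h
    exact hnear (.of_twin hB hcard hu h2 h1u h)
  have dy : 1 < degB n (del B u) y₁ := by
    by_contra! h
    exact hnear (.of_twin hB hcard hu h2 hu1.symm h)
  have dx' : 1 < degB n B x₁ := dx.trans_le (degB_mono del_subset _)
  have dy' : 1 < degB n B y₁ := dy.trans_le (degB_mono del_subset _)
  by_cases huyB : s(u, y₂) ∈ B
  · exact hnear (.of_path hB hcard hS hu h2 dx' h12.symm h1u hu1 h12' hux.symm hxy huy hB1 hB2
      huyB)
  by_cases huxB : s(u, x₂) ∈ B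
  · exact hnear (.of_path hB hcard hS hu h2 dy' h12'.symm hu1.symm h1u.symm h12 huy.symm
      hxy.symm hux (by rwa [Sym2.eq_swap]) (by rwa [Sym2.eq_swap]) huxB)
  have hM := hB.delete (i := x₁) ⟨u, x₂, h1u.symm, h12, hux, huxB⟩ h4
  have hM2 := (hM.delete (i := y₁) ⟨u, y₂, hu1.erase h1u.2.2.1.symm hxy.symm,
    h12'.erase hxy.symm n2.symm, huy, fun h => huyB (del_subset h)⟩ hM.four_le_card).card_le
  rw [Finset.card_erase_of_mem (Finset.mem_erase.2 ⟨hxy.symm, hu1.2.1⟩),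
    Finset.card_erase_of_mem h1u.1] at hM2
  have dy2 : degB n (del B u) y₁ ≤ degB n (del B x₁) y₁ := by
    refine Finset.card_le_card fun e he => ?_
    rw [Finset.mem_filter, mem_del] at he
    refine Finset.mem_filter.2 ⟨mem_del.2 ⟨he.1.1, fun hx => hxyB ?_⟩, he.2⟩
    rw [← (Sym2.mem_and_mem_iff hxy).1 ⟨hx, he.2⟩]
    exact he.1.1
  have := degB_add_card_del B x₁
  have := degB_add_card_del (del B x₁) y₁
  omega

theorem isBlocker_iff : IsBlocker n B ↔ IsBlockerOn n Finset.univ B := by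
  simp [IsBlocker, IsBlockerOn, IsEdge, IsEdgeOn, IsTriangulation, IsTriangulationOn, IsDiagonal,
    IsDiagonalOn]

end Stability

end ConvexBlocker

open ConvexBlocker in
/-- every saturated blocker of size `n-1` of the convex `n`-gon (`n > 5`) differs
from some blocker of size `n-2` in at most `5` edges. -/
theorem stability_of_almost_minimal_saturated_blockers
    (n : ℕ) (hn : 5 < n) (B : Finset (Sym2 (ZMod n)))
    (hB : IsSaturatedBlocker n B) (hcard : B.card = n - 1) :
    ∃ B' : Finset (Sym2 (ZMod n)), IsBlocker n B' ∧ B'.card = n - 2 ∧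
      (symmDiff B B').card ≤ 5 := by
  have : NeZero n := ⟨by omega⟩
  obtain ⟨hB, hsat⟩ := hB
  rw [isBlocker_iff] at hB
  have hS : (Finset.univ : Finset (ZMod n)).card = n := by
    rw [Finset.card_univ, ZMod.card]
  have hu : ∃ u, Uncovered Finset.univ B u ∧ 1 < degB n B u := by
    by_contra! h
    obtain ⟨e, he, heB⟩ := hB.exists_erase (by omega) h
    exact hsat e he (isBlocker_iff.2 heB)
  obtain ⟨u, hu, hdeg⟩ := hu
  obtain ⟨B', hB', hcard', hdist⟩ := hB.nearMinimal (by omega) (by omega) hu hdeg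
  exact ⟨B', isBlocker_iff.2 hB', by omega, hdist⟩
end

section
/- Let n ≥ 4 and let 0 < a < b < c ≤ n−1 be integers, determining the partition of the vertices of the convex n-gon into four nonempty consecutive arcs V_R = {0,…,a−1}, V_B = {a,…,b−1}, V_L = {b,…,c−1}, V_T = {c,…,n−1}. Let B_Q be the set of all edges {i,j} with i ∈ V_R and j ∈ V_L together with all edges {i,j} with i ∈ V_T and j ∈ V_B. Then B_Q is a saturated blocker of the convex n-gon with exactly |V_R|·|V_L| + |V_T|·|V_B| edges. -/
open Finset

namespace ConvexBlocker

lemma val_natCast_sub_natCast {n x y : ℕ} (hx : x < n) (hy : y < n) :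
    ((y : ZMod n) - (x : ZMod n)).val = if x ≤ y then y - x else n + y - x := by
  have : NeZero n := ⟨by omega⟩
  split_ifs with h
  · rw [← Nat.cast_sub h, ZMod.val_cast_of_lt (by omega)]
  · have : (y : ZMod n) - (x : ZMod n) = ((n + y - x : ℕ) : ZMod n) := by
      rw [Nat.cast_sub (by omega)]
      simp
    rw [this, ZMod.val_cast_of_lt (by omega)]

lemma natCast_inj_of_lt {n x y : ℕ} (hx : x < n) (hy : y < n) :
    (x : ZMod n) = y ↔ x = y := by
  rw [ZMod.natCast_eq_natCast_iff', Nat.mod_eq_of_lt hx, Nat.mod_eq_of_lt hy]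

lemma exists_natCast_eq {n : ℕ} (hn : 0 < n) (v : ZMod n) : ∃ x < n, (x : ZMod n) = v := by
  have : NeZero n := ⟨by omega⟩
  exact ⟨v.val, v.val_lt, by simp⟩

lemma sym2_natCast_eq_iff {n x y u v : ℕ} (hx : x < n) (hy : y < n) (hu : u < n) (hv : v < n) :
    s((x : ZMod n), (y : ZMod n)) = s((u : ZMod n), (v : ZMod n)) ↔
      (x = u ∧ y = v) ∨ (x = v ∧ y = u) := by
  rw [Sym2.eq_iff, natCast_inj_of_lt hx hu, natCast_inj_of_lt hy hv, natCast_inj_of_lt hx hv,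
    natCast_inj_of_lt hy hu]

/-- Crossing of two edges in terms of the labels `0, …, n - 1`. -/
lemma cross_natCast_iff {n x y u v : ℕ} (hxy : x < y) (hy : y < n) (huv : u < v) (hv : v < n) :
    Cross n s((x : ZMod n), (y : ZMod n)) s((u : ZMod n), (v : ZMod n)) ↔
      (x < u ∧ u < y ∧ y < v) ∨ (u < x ∧ x < v ∧ v < y) := by
  have hx : x < n := by omega
  have hu : u < n := by omega
  constructor
  · rintro ⟨a, b, c, d, h₁, h₂, h⟩
    obtain ⟨a, ha, rfl⟩ := exists_natCast_eq (by omega) a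
    obtain ⟨b, hb, rfl⟩ := exists_natCast_eq (by omega) b
    obtain ⟨c, hc, rfl⟩ := exists_natCast_eq (by omega) c
    obtain ⟨d, hd, rfl⟩ := exists_natCast_eq (by omega) d
    rw [sym2_natCast_eq_iff hx hy ha hb] at h₁
    rw [sym2_natCast_eq_iff hu hv hc hd] at h₂
    rw [val_natCast_sub_natCast ha hb, val_natCast_sub_natCast ha hc,
      val_natCast_sub_natCast ha hd] at h
    split_ifs at h <;> omega
  · rintro (h | h)
    · refine ⟨x, y, u, v, rfl, rfl, ?_⟩
      rw [val_natCast_sub_natCast hx hy, val_natCast_sub_natCast hx hu,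
        val_natCast_sub_natCast hx hv]
      split_ifs <;> omega
    · refine ⟨x, y, v, u, rfl, Sym2.eq_swap, ?_⟩
      rw [val_natCast_sub_natCast hx hy, val_natCast_sub_natCast hx hu,
        val_natCast_sub_natCast hx hv]
      split_ifs <;> omega

/-- The pairs `x < y` of labels in `0, …, n - 1` joined by a diagonal of the convex `n`-gon. -/
def IsDiagonalPair (n x y : ℕ) : Prop :=
  x + 2 ≤ y ∧ y < n ∧ (0 < x ∨ y + 1 < n)

lemma IsDiagonalPair.isDiagonal {n x y : ℕ} (h : IsDiagonalPair n x y) :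
    IsDiagonal n s((x : ZMod n), (y : ZMod n)) := by
  obtain ⟨hxy, hy, h⟩ := h
  refine ⟨x, y, rfl, ?_, ⟨(x + 1 : ℕ), ?_⟩, ?_⟩
  · rw [Ne, natCast_inj_of_lt (by omega) hy]
    omega
  · rw [Btw, val_natCast_sub_natCast (by omega) (by omega),
      val_natCast_sub_natCast (by omega) (by omega)]
    split_ifs <;> omega
  · rcases h with h | h
    · refine ⟨(0 : ℕ), ?_⟩
      rw [Btw, val_natCast_sub_natCast (by omega) (by omega),
        val_natCast_sub_natCast (by omega) (by omega)]
      split_ifs <;> omega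
    · refine ⟨(y + 1 : ℕ), ?_⟩
      rw [Btw, val_natCast_sub_natCast (by omega) (by omega),
        val_natCast_sub_natCast (by omega) (by omega)]
      split_ifs <;> omega

lemma IsDiagonal.exists_isDiagonalPair {n : ℕ} (hn : 0 < n) {e : Sym2 (ZMod n)}
    (he : IsDiagonal n e) :
    ∃ x y : ℕ, IsDiagonalPair n x y ∧ e = s((x : ZMod n), (y : ZMod n)) := by
  obtain ⟨x, y, rfl, -, ⟨c, hc⟩, ⟨d, hd⟩⟩ := he
  obtain ⟨x, hx, rfl⟩ := exists_natCast_eq hn x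
  obtain ⟨y, hy, rfl⟩ := exists_natCast_eq hn y
  obtain ⟨c, hc', rfl⟩ := exists_natCast_eq hn c
  obtain ⟨d, hd', rfl⟩ := exists_natCast_eq hn d
  rw [Btw, val_natCast_sub_natCast hx hc', val_natCast_sub_natCast hx hy] at hc
  rw [Btw, val_natCast_sub_natCast hy hd', val_natCast_sub_natCast hy hx] at hd
  rcases lt_or_ge x y with h | h
  · refine ⟨x, y, ?_, rfl⟩
    unfold IsDiagonalPair
    split_ifs at hc hd <;> omega
  · refine ⟨y, x, ?_, Sym2.eq_swap⟩
    unfold IsDiagonalPair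
    split_ifs at hc hd <;> omega

/-- Each edge `{i, j}` of a triangulated polygon with `i + 2 ≤ j` which is a side or belongs to the
triangulation is a side of a triangle `{i, k, j}` with `i < k < j`. -/
lemma IsTriangulation.exists_triangle {n : ℕ} {T : Finset (Sym2 (ZMod n))}
    (hT : IsTriangulation n T) {i j : ℕ} (hij : i + 2 ≤ j) (hj : j < n)
    (hijT : IsDiagonalPair n i j → s((i : ZMod n), (j : ZMod n)) ∈ T) :
    ∃ k, i < k ∧ k < j ∧ (IsDiagonalPair n i k → s((i : ZMod n), (k : ZMod n)) ∈ T) ∧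
      (IsDiagonalPair n k j → s((k : ZMod n), (j : ZMod n)) ∈ T) := by
  classical
  obtain ⟨hdiag, hcross, hmax⟩ := hT
  have hex : ∃ k, i < k ∧ k < j ∧ (IsDiagonalPair n k j → s((k : ZMod n), (j : ZMod n)) ∈ T) :=
    ⟨j - 1, by omega, by omega, fun h => by unfold IsDiagonalPair at h; omega⟩
  obtain ⟨hik, hkj, hkT⟩ := Nat.find_spec hex
  have hmin : ∀ m < Nat.find hex, _ := fun m hm => Nat.find_min hex hm
  generalize Nat.find hex = k at *
  refine ⟨k, hik, hkj, fun hd => ?_, hkT⟩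
  by_contra hnot
  obtain ⟨f, hf, hc⟩ := hmax _ hd.isDiagonal hnot
  obtain ⟨x, y, hxy, rfl⟩ := (hdiag f hf).exists_isDiagonalPair (by omega)
  have hxy' := hxy
  unfold IsDiagonalPair at hxy'
  rw [cross_natCast_iff hik (by omega) (by omega) (by omega)] at hc
  have h₁ : ¬ ((i < x ∧ x < j ∧ j < y) ∨ (x < i ∧ i < y ∧ y < j)) := by
    by_cases h : IsDiagonalPair n i j
    · rw [← cross_natCast_iff (by omega) hj (by omega) hxy'.2.1]
      exact hcross _ (hijT h) _ hf
    · unfold IsDiagonalPair at h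
      omega
  have h₂ : ¬ ((k < x ∧ x < j ∧ j < y) ∨ (x < k ∧ k < y ∧ y < j)) := by
    by_cases h : IsDiagonalPair n k j
    · rw [← cross_natCast_iff (by omega) hj (by omega) hxy'.2.1]
      exact hcross _ (hkT h) _ hf
    · unfold IsDiagonalPair at h
      omega
  obtain rfl : y = j := by omega
  exact hmin x (by omega) ⟨by omega, by omega, fun _ => hf⟩

/-- The pairs `x < y` of labels making up the triangulation that contains `{i, j}` and consists,
apart from it, of the fan at `p` on one side of `{i, j}` and the fan at `q` on the other side. -/
def IsDoubleFanPair (i j p q x y : ℕ) : Prop :=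
  (x = i ∧ y = j) ∨ (x = p ∧ y ≤ j) ∨ (y = p ∧ i ≤ x) ∨
    (x = q ∧ (y ≤ i ∨ j ≤ y)) ∨ (y = q ∧ (x ≤ i ∨ j ≤ x))

lemma exists_crossing_doubleFanPair {n i j p q x y : ℕ} (hip : i < p) (hpj : p < j) (hj : j < n)
    (hq : q < n) (hqij : q < i ∨ j < q) (hxy : IsDiagonalPair n x y)
    (h : ¬ IsDoubleFanPair i j p q x y) :
    ∃ u v, IsDiagonalPair n u v ∧ IsDoubleFanPair i j p q u v ∧
      ((x < u ∧ u < y ∧ y < v) ∨ (u < x ∧ x < v ∧ v < y)) := by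
  unfold IsDiagonalPair IsDoubleFanPair at *
  by_cases hc : (x < i ∧ i < y ∧ y < j) ∨ (i < x ∧ x < j ∧ j < y)
  · exact ⟨i, j, by omega, by omega, by omega⟩
  by_cases hin : i ≤ x ∧ y ≤ j
  · by_cases h₁ : y < p
    · exact ⟨x + 1, p, by omega, by omega, by omega⟩
    by_cases h₂ : p < x
    · exact ⟨p, x + 1, by omega, by omega, by omega⟩
    by_cases h₃ : i < x
    · exact ⟨i, p, by omega, by omega, by omega⟩
    · exact ⟨p, j, by omega, by omega, by omega⟩
  rcases hqij with hqij | hqij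
  · by_cases h₁ : y < q
    · exact ⟨x + 1, q, by omega, by omega, by omega⟩
    by_cases h₂ : x < q
    · by_cases h₃ : 0 < x
      · exact ⟨0, q, by omega, by omega, by omega⟩
      by_cases h₄ : y = i
      · exact ⟨q, j, by omega, by omega, by omega⟩
      · exact ⟨q, y + 1, by omega, by omega, by omega⟩
    by_cases h₃ : x < i
    · by_cases h₄ : y ≤ i
      · exact ⟨q, x + 1, by omega, by omega, by omega⟩
      · exact ⟨q, i, by omega, by omega, by omega⟩
    by_cases h₄ : x < j
    · exact ⟨q, j, by omega, by omega, by omega⟩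
    · exact ⟨q, x + 1, by omega, by omega, by omega⟩
  · by_cases h₁ : q < x
    · exact ⟨q, x + 1, by omega, by omega, by omega⟩
    by_cases h₂ : q < y
    · by_cases h₃ : 0 < x
      · exact ⟨0, q, by omega, by omega, by omega⟩
      · exact ⟨q, y + 1, by omega, by omega, by omega⟩
    by_cases h₃ : y ≤ i ∨ j ≤ x
    · exact ⟨x + 1, q, by omega, by omega, by omega⟩
    by_cases h₄ : x < i
    · exact ⟨i, q, by omega, by omega, by omega⟩
    · exact ⟨j, q, by omega, by omega, by omega⟩

/-- A convex polygon has a triangulation consisting of a diagonal `{i, j}` and a fan on each of its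
two sides. -/
lemma exists_doubleFan_triangulation {n i j p q : ℕ} (hip : i < p) (hpj : p < j) (hj : j < n)
    (hq : q < n) (hqij : q < i ∨ j < q) :
    ∃ T : Finset (Sym2 (ZMod n)), IsTriangulation n T ∧
      ∀ e ∈ T, ∃ x y, IsDiagonalPair n x y ∧ IsDoubleFanPair i j p q x y ∧
        e = s((x : ZMod n), (y : ZMod n)) := by
  classical
  let T : Finset (Sym2 (ZMod n)) :=
    ((range n ×ˢ range n).filter
      (fun z => IsDiagonalPair n z.1 z.2 ∧ IsDoubleFanPair i j p q z.1 z.2)).image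
        (fun z => s((z.1 : ZMod n), (z.2 : ZMod n)))
  have hmem : ∀ e, e ∈ T ↔ ∃ x y, IsDiagonalPair n x y ∧ IsDoubleFanPair i j p q x y ∧
      e = s((x : ZMod n), (y : ZMod n)) := by
    intro e
    simp only [T, mem_image, mem_filter, mem_product, mem_range, Prod.exists]
    constructor
    · rintro ⟨x, y, ⟨-, h₁, h₂⟩, rfl⟩
      exact ⟨x, y, h₁, h₂, rfl⟩
    · rintro ⟨x, y, h₁, h₂, rfl⟩
      exact ⟨x, y, ⟨⟨by unfold IsDiagonalPair at h₁; omega, h₁.2.1⟩, h₁, h₂⟩, rfl⟩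
  refine ⟨T, ⟨?_, ?_, ?_⟩, fun e he => (hmem e).1 he⟩
  · intro e he
    obtain ⟨x, y, h, -, rfl⟩ := (hmem e).1 he
    exact h.isDiagonal
  · intro e he f hf
    obtain ⟨x, y, hxy, h₁, rfl⟩ := (hmem e).1 he
    obtain ⟨u, v, huv, h₂, rfl⟩ := (hmem f).1 hf
    unfold IsDiagonalPair at hxy huv
    rw [cross_natCast_iff (by omega) (by omega) (by omega) (by omega)]
    unfold IsDoubleFanPair at h₁ h₂
    omega
  · intro e he heT
    obtain ⟨x, y, hxy, rfl⟩ := he.exists_isDiagonalPair (by omega)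
    obtain ⟨u, v, huv, hfan, hc⟩ := exists_crossing_doubleFanPair hip hpj hj hq hqij hxy
      (fun h => heT ((hmem _).2 ⟨x, y, hxy, h, rfl⟩))
    refine ⟨_, (hmem _).2 ⟨u, v, huv, hfan, rfl⟩, ?_⟩
    unfold IsDiagonalPair at hxy huv
    rwa [cross_natCast_iff (by omega) (by omega) (by omega) (by omega)]

/-- The pairs `x < y` of labels forming the quadrilateral set of edges. -/
def IsQuadPair (a b c x y : ℕ) : Prop :=
  (x < a ∧ b ≤ y ∧ y < c) ∨ (a ≤ x ∧ x < b ∧ c ≤ y)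

end ConvexBlocker

open ConvexBlocker in
/-- the "quadrilateral" set of edges `B_Q` (all edges between the arcs `V_R` and
`V_L` together with all edges between `V_T` and `V_B`) is a saturated blocker of the convex
`n`-gon with exactly `|V_R|·|V_L| + |V_T|·|V_B|` edges. -/
theorem quadrilateral_blocker
    (n a b c : ℕ) (hn : 4 ≤ n) (ha : 0 < a) (hab : a < b) (hbc : b < c) (hc : c ≤ n - 1)
    (BQ : Finset (Sym2 (ZMod n)))
    (hBQ : BQ =
      ((Finset.range a ×ˢ Finset.Ico b c).image
        (fun p => s((p.1 : ZMod n), (p.2 : ZMod n)))) ∪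
      ((Finset.Ico c n ×ˢ Finset.Ico a b).image
        (fun p => s((p.1 : ZMod n), (p.2 : ZMod n))))) :
    IsSaturatedBlocker n BQ ∧ BQ.card = a * (c - b) + (n - c) * (b - a) := by
  classical
  have hmem : ∀ e, e ∈ BQ ↔ ∃ x y : ℕ, x < y ∧ y < n ∧ IsQuadPair a b c x y ∧
      e = s((x : ZMod n), (y : ZMod n)) := by
    intro e
    simp only [hBQ, mem_union, mem_image, mem_product, mem_range, mem_Ico, Prod.exists]
    unfold IsQuadPair
    constructor
    · rintro (⟨x, y, h, rfl⟩ | ⟨x, y, h, rfl⟩)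
      · exact ⟨x, y, by omega, by omega, by omega, rfl⟩
      · exact ⟨y, x, by omega, by omega, by omega, Sym2.eq_swap⟩
    · rintro ⟨x, y, hxy, hy, h | h, rfl⟩
      · exact .inl ⟨x, y, by omega, rfl⟩
      · exact .inr ⟨y, x, by omega, Sym2.eq_swap⟩
  have hedge : ∀ e ∈ BQ, IsEdge n e := by
    intro e he
    obtain ⟨x, y, hxy, hy, -, rfl⟩ := (hmem e).1 he
    refine ⟨x, y, rfl, ?_⟩
    rw [Ne, natCast_inj_of_lt (by omega) hy]
    omega
  refine ⟨⟨⟨hedge, fun T hT => ?_⟩, fun e he hblock => ?_⟩, ?_⟩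
  · -- Take a shortest edge `{i, i + d}` joining `V_R` to `V_T` and the triangle on its inner side.
    have hex : ∃ d i, i < a ∧ c ≤ i + d ∧ i + d < n ∧
        (IsDiagonalPair n i (i + d) → s((i : ZMod n), ((i + d : ℕ) : ZMod n)) ∈ T) :=
      ⟨n - 1, 0, ha, by omega, by omega, fun h => by unfold IsDiagonalPair at h; omega⟩
    obtain ⟨i, hi, hc', hd, hiT⟩ := Nat.find_spec hex
    have hmin : ∀ m < Nat.find hex, _ := fun m hm => Nat.find_min hex hm
    generalize Nat.find hex = d at *
    obtain ⟨k, hik, hkj, h₁, h₂⟩ := hT.exists_triangle (by omega) hd hiT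
    rcases lt_or_ge k a with hka | hka
    · refine absurd ⟨k, hka, by omega, by omega, ?_⟩ (hmin (i + d - k) (by omega))
      rwa [show k + (i + d - k) = i + d by omega]
    rcases lt_or_ge k b with hkb | hkb
    · refine ⟨_, mem_inter.2 ⟨(hmem _).2 ⟨k, i + d, by omega, hd, ?_, rfl⟩, h₂ ?_⟩⟩
      · unfold IsQuadPair; omega
      · unfold IsDiagonalPair; omega
    rcases lt_or_ge k c with hkc | hkc
    · refine ⟨_, mem_inter.2 ⟨(hmem _).2 ⟨i, k, by omega, by omega, ?_, rfl⟩, h₁ ?_⟩⟩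
      · unfold IsQuadPair; omega
      · unfold IsDiagonalPair; omega
    · refine absurd ⟨i, hi, by omega, by omega, ?_⟩ (hmin (k - i) (by omega))
      rwa [show i + (k - i) = k by omega]
  · obtain ⟨i, j, hij, hj, hquad, rfl⟩ := (hmem e).1 he
    have havoid : ∃ p q, i < p ∧ p < j ∧ q < n ∧ (q < i ∨ j < q) ∧
        ∀ x y, x < y → y < n → IsDoubleFanPair i j p q x y → IsQuadPair a b c x y →
          x = i ∧ y = j := by
      unfold IsDoubleFanPair IsQuadPair at *
      rcases hquad with h | h
      · exact ⟨a, c, by omega, by omega, by omega, by omega, by omega⟩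
      · exact ⟨b, 0, by omega, by omega, by omega, by omega, by omega⟩
    obtain ⟨p, q, hip, hpj, hq, hqij, havoid⟩ := havoid
    obtain ⟨T, hT, hTfan⟩ := exists_doubleFan_triangulation hip hpj hj hq hqij
    obtain ⟨f, hf⟩ := hblock.2 T hT
    rw [mem_inter, mem_erase] at hf
    obtain ⟨⟨hne, hfB⟩, hfT⟩ := hf
    obtain ⟨x, y, hd, hfan, rfl⟩ := hTfan f hfT
    obtain ⟨u, v, huv, hv, hQ, heq⟩ := (hmem _).1 hfB
    unfold IsDiagonalPair at hd
    rw [sym2_natCast_eq_iff (by omega) (by omega) (by omega) hv] at heq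
    obtain ⟨rfl, rfl⟩ : x = u ∧ y = v := by omega
    obtain ⟨rfl, rfl⟩ := havoid x y huv hv hfan hQ
    exact hne rfl
  · rw [hBQ, card_union_of_disjoint, card_image_of_injOn, card_image_of_injOn]
    · simp
    · rintro ⟨x, y⟩ h ⟨u, v⟩ h' heq
      simp only [coe_product, Set.mem_prod, coe_Ico, Set.mem_Ico] at h h'
      rw [sym2_natCast_eq_iff (by omega) (by omega) (by omega) (by omega)] at heq
      rw [Prod.mk.injEq]
      omega
    · rintro ⟨x, y⟩ h ⟨u, v⟩ h' heq
      simp only [coe_product, Set.mem_prod, coe_Ico, Set.mem_Ico, coe_range, Set.mem_Iio] at h h'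
      rw [sym2_natCast_eq_iff (by omega) (by omega) (by omega) (by omega)] at heq
      rw [Prod.mk.injEq]
      omega
    · rw [disjoint_left]
      simp only [mem_image, mem_product, mem_range, mem_Ico, Prod.exists]
      rintro e ⟨x, y, h, rfl⟩ ⟨u, v, h', heq⟩
      rw [sym2_natCast_eq_iff (by omega) (by omega) (by omega) (by omega)] at heq
      omega
end

section
/- Let n ≥ 4 and let 0 < a < b < c ≤ n−1 determine the four nonempty consecutive arcs V_R = {0,…,a−1}, V_B = {a,…,b−1}, V_L = {b,…,c−1}, V_T = {c,…,n−1}, and let B_Q be the set of all edges between V_R and V_L together with all edges between V_T and V_B. Assume |V_L| ≥ 3, |V_R| ≥ 3, |V_T| ≥ 2 and |V_B| ≥ 2. Let B_T be a saturated blocker of the convex polygon on the vertex set V_T ∪ {0, c−1} and let B_B be a saturated blocker of the convex polygon on the vertex set V_B ∪ {a−1, b}. Then B_M = (B_Q ∖ {{0,c−1},{a−1,b}}) ∪ B_T ∪ B_B is a saturated blocker of the convex n-gon with exactly |V_T|·|V_B| + |V_L|·|V_R| + |B_T| + |B_B| − 2 edges. -/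
open Finset

namespace ConvexBlocker

/-- The edge of the `n`-gon joining the vertices labelled `p` and `q`. -/
def chord (n p q : ℕ) : Sym2 (ZMod n) := s((p : ZMod n), (q : ZMod n))

theorem cast_inj_of_lt {n p q : ℕ} (hp : p < n) (hq : q < n) :
    (p : ZMod n) = (q : ZMod n) ↔ p = q := by
  rw [ZMod.natCast_eq_natCast_iff', Nat.mod_eq_of_lt hp, Nat.mod_eq_of_lt hq]

theorem exists_cast_eq {n : ℕ} [NeZero n] (x : ZMod n) : ∃ p < n, x = (p : ZMod n) :=
  ⟨x.val, ZMod.val_lt x, (ZMod.natCast_zmod_val x).symm⟩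

theorem val_cast_sub {n p q : ℕ} (hp : p < n) (hq : q < n) :
    ((p : ZMod n) - (q : ZMod n)).val = if q ≤ p then p - q else n + p - q := by
  split_ifs with h
  · rw [← Nat.cast_sub h, ZMod.val_natCast, Nat.mod_eq_of_lt (by omega)]
  · have : (p : ZMod n) - (q : ZMod n) = ((n + p - q : ℕ) : ZMod n) := by
      rw [Nat.cast_sub (by omega)]; simp
    rw [this, ZMod.val_natCast, Nat.mod_eq_of_lt (by omega)]

theorem chord_comm (n p q : ℕ) : chord n p q = chord n q p := Sym2.eq_swap

theorem chord_eq_iff {n p q r s : ℕ} (hp : p < n) (hq : q < n) (hr : r < n) (hs : s < n) :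
    chord n p q = chord n r s ↔ (p = r ∧ q = s) ∨ (p = s ∧ q = r) := by
  simp only [chord, Sym2.eq_iff, cast_inj_of_lt, *]

theorem exists_chord_eq {n : ℕ} [NeZero n] (e : Sym2 (ZMod n)) :
    ∃ p q, p ≤ q ∧ q < n ∧ e = chord n p q := by
  induction e with | _ x y
  obtain ⟨p, hp, rfl⟩ := exists_cast_eq x
  obtain ⟨q, hq, rfl⟩ := exists_cast_eq y
  rcases le_total p q with h | h
  · exact ⟨p, q, h, hq, rfl⟩
  · exact ⟨q, p, h, hp, chord_comm n p q⟩

theorem cross_chord_iff {n p q r s : ℕ} (hpq : p < q) (hq : q < n) (hrs : r < s) (hs : s < n) :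
    Cross n (chord n p q) (chord n r s) ↔
      (p < r ∧ r < q ∧ q < s) ∨ (r < p ∧ p < s ∧ s < q) := by
  have : NeZero n := ⟨by omega⟩
  constructor
  · rintro ⟨w, x, y, z, he, hf, h⟩
    obtain ⟨w, hw, rfl⟩ := exists_cast_eq w
    obtain ⟨x, hx, rfl⟩ := exists_cast_eq x
    obtain ⟨y, hy, rfl⟩ := exists_cast_eq y
    obtain ⟨z, hz, rfl⟩ := exists_cast_eq z
    rw [← chord, chord_eq_iff (by omega) (by omega) hw hx] at he
    rw [← chord, chord_eq_iff (by omega) (by omega) hy hz] at hf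
    rw [val_cast_sub hy hw, val_cast_sub hx hw, val_cast_sub hz hw] at h
    split_ifs at h <;> omega
  · rintro (h | h)
    · refine ⟨p, q, r, s, rfl, rfl, ?_⟩
      rw [val_cast_sub (by omega) (by omega), val_cast_sub (by omega) (by omega),
        val_cast_sub (by omega) (by omega)]
      split_ifs <;> omega
    · refine ⟨p, q, s, r, rfl, chord_comm n r s, ?_⟩
      rw [val_cast_sub (by omega) (by omega), val_cast_sub (by omega) (by omega),
        val_cast_sub (by omega) (by omega)]
      split_ifs <;> omega

theorem btw_cast_iff {n p m q : ℕ} (hp : p < n) (hm : m < n) (hq : q < n) :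
    Btw n p m q ↔ (p < m ∧ m < q) ∨ (q < p ∧ (m < q ∨ p < m)) := by
  rw [Btw, val_cast_sub hm hp, val_cast_sub hq hp]
  split_ifs <;> omega

theorem isDiagonalOn_chord_iff {n p q : ℕ} {S : Finset (ZMod n)} (hpq : p < q) (hq : q < n) :
    IsDiagonalOn n S (chord n p q) ↔ (p : ZMod n) ∈ S ∧ (q : ZMod n) ∈ S ∧
      (∃ m : ℕ, (m : ZMod n) ∈ S ∧ p < m ∧ m < q) ∧
      (∃ m : ℕ, m < n ∧ (m : ZMod n) ∈ S ∧ (m < p ∨ q < m)) := by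
  have : NeZero n := ⟨by omega⟩
  constructor
  · rintro ⟨x, y, he, hx, hy, hxy, ⟨u, hu, hub⟩, ⟨v, hv, hvb⟩⟩
    obtain ⟨x, hx', rfl⟩ := exists_cast_eq x
    obtain ⟨y, hy', rfl⟩ := exists_cast_eq y
    obtain ⟨u, hu', rfl⟩ := exists_cast_eq u
    obtain ⟨v, hv', rfl⟩ := exists_cast_eq v
    rw [← chord, chord_eq_iff (by omega) (by omega) hx' hy'] at he
    rw [btw_cast_iff hx' hu' hy'] at hub
    rw [btw_cast_iff hy' hv' hx'] at hvb
    rcases he with ⟨rfl, rfl⟩ | ⟨rfl, rfl⟩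
    · exact ⟨hx, hy, ⟨u, hu, by omega⟩, ⟨v, hv', hv, by omega⟩⟩
    · exact ⟨hy, hx, ⟨v, hv, by omega⟩, ⟨u, hu', hu, by omega⟩⟩
  · rintro ⟨hpS, hqS, ⟨u, hu, hub⟩, ⟨v, hvn, hv, hvb⟩⟩
    refine ⟨p, q, rfl, hpS, hqS, ?_, ⟨u, hu, ?_⟩, ⟨v, hv, ?_⟩⟩
    · rw [Ne, cast_inj_of_lt (by omega) hq]; omega
    · rw [btw_cast_iff (by omega) (by omega) hq]; omega
    · rw [btw_cast_iff hq hvn (by omega)]; omega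

theorem isDiagonal_iff_isDiagonalOn_univ {n : ℕ} [NeZero n] (e : Sym2 (ZMod n)) :
    IsDiagonal n e ↔ IsDiagonalOn n Finset.univ e := by
  simp [IsDiagonal, IsDiagonalOn]

theorem isDiagonal_chord_iff {n p q : ℕ} (hpq : p < q) (hq : q < n) :
    IsDiagonal n (chord n p q) ↔ p + 2 ≤ q ∧ ¬ (p = 0 ∧ q = n - 1) := by
  have : NeZero n := ⟨by omega⟩
  rw [isDiagonal_iff_isDiagonalOn_univ, isDiagonalOn_chord_iff hpq hq]
  simp only [Finset.mem_univ, true_and]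
  constructor
  · rintro ⟨⟨m, hm⟩, ⟨k, hk⟩⟩; omega
  · rintro ⟨h₁, h₂⟩
    refine ⟨⟨p + 1, by omega⟩, ?_⟩
    by_cases hp : p = 0
    · exact ⟨n - 1, by omega⟩
    · exact ⟨0, by omega⟩

/-- The endpoints of an edge may be listed in increasing order. -/
theorem IsEdge.exists_lt {n : ℕ} [NeZero n] {e : Sym2 (ZMod n)}
    (he : IsEdge n e) : ∃ p q, p < q ∧ q < n ∧ e = chord n p q := by
  obtain ⟨x, y, rfl, hxy⟩ := he
  obtain ⟨p, q, hpq, hq, h⟩ := exists_chord_eq s(x, y)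
  refine ⟨p, q, lt_of_le_of_ne hpq ?_, hq, h⟩
  rintro rfl
  rw [chord, Sym2.eq_iff] at h
  rcases h with ⟨h₁, h₂⟩ | ⟨h₁, h₂⟩ <;> exact hxy (h₁.trans h₂.symm)

theorem IsDiagonalOn.exists_lt {n : ℕ} [NeZero n] {S : Finset (ZMod n)} {e : Sym2 (ZMod n)}
    (he : IsDiagonalOn n S e) : ∃ p q, p < q ∧ q < n ∧ e = chord n p q := by
  obtain ⟨x, y, h, -, -, hxy, -⟩ := he
  exact IsEdge.exists_lt ⟨x, y, h, hxy⟩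

theorem IsDiagonal.exists_lt {n : ℕ} [NeZero n] {e : Sym2 (ZMod n)}
    (he : IsDiagonal n e) : ∃ p q, p < q ∧ q < n ∧ e = chord n p q :=
  ((isDiagonal_iff_isDiagonalOn_univ e).1 he).exists_lt

theorem isEdge_chord {n p q : ℕ} (hpq : p < q) (hq : q < n) : IsEdge n (chord n p q) :=
  ⟨p, q, rfl, by rw [Ne, cast_inj_of_lt (by omega) hq]; omega⟩

/-- Every set of pairwise non-crossing diagonals extends to a triangulation. -/
theorem exists_triangulation_superset {n : ℕ} [NeZero n] {F : Finset (Sym2 (ZMod n))}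
    (hd : ∀ e ∈ F, IsDiagonal n e) (hF : ∀ e ∈ F, ∀ f ∈ F, ¬ Cross n e f) :
    ∃ T, IsTriangulation n T ∧ F ⊆ T := by
  classical
  obtain ⟨T, hFT, hT⟩ := Set.Finite.exists_le_maximal
    (s := {T : Finset (Sym2 (ZMod n)) | (∀ e ∈ T, IsDiagonal n e) ∧
      ∀ e ∈ T, ∀ f ∈ T, ¬ Cross n e f}) (Set.toFinite _) (a := F) ⟨hd, hF⟩
  refine ⟨T, ⟨hT.prop.1, hT.prop.2, ?_⟩, hFT⟩
  intro e he heT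
  by_contra! hcon
  apply heT
  apply hT.le_of_ge (y := insert e T) ⟨?_, ?_⟩ (Finset.subset_insert e T)
    (Finset.mem_insert_self e T)
  · simp only [Finset.mem_insert]
    rintro f (rfl | hf)
    · exact he
    · exact hT.prop.1 f hf
  · have hsymm : ∀ f ∈ T, ¬ Cross n f e := by
      intro f hf hc
      obtain ⟨p, q, hpq, hq, rfl⟩ := he.exists_lt
      obtain ⟨r, s, hrs, hs, rfl⟩ := (hT.prop.1 f hf).exists_lt
      apply hcon _ hf
      rw [cross_chord_iff hpq hq hrs hs]
      rw [cross_chord_iff hrs hs hpq hq] at hc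
      omega
    have hself : ¬ Cross n e e := by
      obtain ⟨p, q, hpq, hq, rfl⟩ := he.exists_lt
      rw [cross_chord_iff hpq hq hpq hq]
      omega
    simp only [Finset.mem_insert]
    rintro f (rfl | hf) g (rfl | hg)
    · exact hself
    · exact hcon g hg
    · exact hsymm f hf
    · exact hT.prop.2 f hf g hg

/-- A set of edges each of which crosses a member of a fixed non-crossing family
is not a blocker. -/
theorem not_isBlocker_of_crossed {n : ℕ} [NeZero n] {B : Finset (Sym2 (ZMod n))}
    (P : ℕ → ℕ → Prop)
    (hP : ∀ p q r s, p < r → r < q → q < s → s < n → P p q → P r s → False)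
    (hB : ∀ x y, x < y → y < n → chord n x y ∈ B → ∃ p q, p < q ∧ q < n ∧ P p q ∧
      ((x < p ∧ p < y ∧ y < q) ∨ (p < x ∧ x < q ∧ q < y))) :
    ¬ IsBlocker n B := by
  classical
  rintro ⟨hE, hBl⟩
  obtain ⟨T, hT, hFT⟩ := exists_triangulation_superset
    (F := Finset.univ.filter fun e => IsDiagonal n e ∧
      ∃ p q, p < q ∧ q < n ∧ P p q ∧ e = chord n p q)
    (by simp +contextual) (by
      simp only [Finset.mem_filter, Finset.mem_univ, true_and]
      rintro _ ⟨-, p, q, hpq, hq, hPpq, rfl⟩ _ ⟨-, r, s, hrs, hs, hPrs, rfl⟩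
      rw [cross_chord_iff hpq hq hrs hs]
      rintro (h | h)
      · exact hP p q r s h.1 h.2.1 h.2.2 hs hPpq hPrs
      · exact hP r s p q h.1 h.2.1 h.2.2 hq hPrs hPpq)
  obtain ⟨f, hf⟩ := hBl T hT
  rw [Finset.mem_inter] at hf
  obtain ⟨x, y, hxy, hy, rfl⟩ := (hE f hf.1).exists_lt
  obtain ⟨p, q, hpq, hq, hPpq, h⟩ := hB x y hxy hy hf.1
  refine hT.2.1 _ hf.2 (chord n p q) (hFT ?_) ((cross_chord_iff hxy hy hpq hq).2 h)
  rw [Finset.mem_filter, isDiagonal_chord_iff hpq hq]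
  exact ⟨Finset.mem_univ _, by omega, p, q, hpq, hq, hPpq, rfl⟩

/-- A member `{p, q}` of a triangulation, or the side `{0, n - 1}`, bounds a triangle whose third
vertex lies strictly between `p` and `q`. -/
theorem IsTriangulation.exists_triangle_s5 {n p q : ℕ} {T : Finset (Sym2 (ZMod n))}
    (hT : IsTriangulation n T) (hpq : p + 2 ≤ q) (hq : q < n)
    (h : chord n p q ∈ T ∨ (p = 0 ∧ q = n - 1)) :
    ∃ z, p < z ∧ z < q ∧ (chord n p z ∈ T ∨ z = p + 1) ∧ (chord n z q ∈ T ∨ q = z + 1) := by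
  classical
  have : NeZero n := ⟨by omega⟩
  obtain ⟨z, hz, hmax⟩ := ((Finset.Ioo p q).filter
    fun z => chord n p z ∈ T ∨ z = p + 1).exists_max_image id
    ⟨p + 1, by simp; omega⟩
  simp only [Finset.mem_filter, Finset.mem_Ioo, id] at hz hmax
  refine ⟨z, hz.1.1, hz.1.2, hz.2, ?_⟩
  by_contra! hcon
  obtain ⟨f, hf, hc⟩ := hT.2.2 (chord n z q)
    ((isDiagonal_chord_iff hz.1.2 hq).2 (by omega)) hcon.1
  obtain ⟨r, s, hrs, hs, rfl⟩ := (hT.1 f hf).exists_lt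
  rw [cross_chord_iff hz.1.2 hq hrs hs] at hc
  have hnot_outer : ¬ ((p < r ∧ r < q ∧ q < s) ∨ (r < p ∧ p < s ∧ s < q)) := by
    rcases h with h | h
    · rw [← cross_chord_iff (by omega) hq hrs hs]
      exact hT.2.1 _ h _ hf
    · omega
  have hnot_inner : ¬ ((p < r ∧ r < z ∧ z < s) ∨ (r < p ∧ p < s ∧ s < z)) := by
    rcases hz.2 with h | h
    · rw [← cross_chord_iff (by omega) (by omega) hrs hs]
      exact hT.2.1 _ h _ hf
    · omega
  obtain rfl : r = p := by omega
  have := hmax s ⟨by omega, Or.inl hf⟩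
  omega

/-- For four consecutive arcs, every triangulation joins two opposite arcs. -/
theorem IsTriangulation.exists_chord_opposite_arcs {n a b c : ℕ} {T : Finset (Sym2 (ZMod n))}
    (hT : IsTriangulation n T) (ha : 0 < a) (hab : a < b) (hbc : b < c) (hc : c < n) :
    (∃ p q, p < a ∧ b ≤ q ∧ q < c ∧ chord n p q ∈ T) ∨
      (∃ p q, a ≤ p ∧ p < b ∧ c ≤ q ∧ q < n ∧ chord n p q ∈ T) := by
  by_contra! hcon
  suffices H : ∀ d p q, q - p = d → p < a → c ≤ q → q < n →
      (chord n p q ∈ T ∨ (p = 0 ∧ q = n - 1)) → False from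
    H _ 0 (n - 1) rfl ha (by omega) (by omega) (Or.inr ⟨rfl, rfl⟩)
  intro d
  induction d using Nat.strong_induction_on with | _ d ih
  intro p q hd hp hcq hq h
  obtain ⟨z, hpz, hzq, h₁, h₂⟩ := hT.exists_triangle_s5 (by omega) hq h
  by_cases hza : z < a
  · exact ih (q - z) (by omega) z q rfl hza hcq hq
      (Or.inl (h₂.resolve_right (by omega)))
  by_cases hzb : z < b
  · exact hcon.2 z q (by omega) hzb hcq hq (h₂.resolve_right (by omega))
  by_cases hzc : z < c
  · exact hcon.1 p z hp (by omega) hzc (h₁.resolve_right (by omega))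
  · exact ih (z - p) (by omega) p z rfl hp (by omega) (by omega)
      (Or.inl (h₁.resolve_right (by omega)))

/-- The members of a saturated blocker are diagonals. -/
theorem IsSaturatedBlockerOn.isDiagonalOn {n : ℕ} {S : Finset (ZMod n)}
    {B : Finset (Sym2 (ZMod n))} (hB : IsSaturatedBlockerOn n S B) {e : Sym2 (ZMod n)}
    (he : e ∈ B) : IsDiagonalOn n S e := by
  by_contra hd
  refine hB.2 e he ⟨fun f hf => hB.1.1 f (Finset.mem_of_mem_erase hf), fun T hT => ?_⟩
  obtain ⟨f, hf⟩ := hB.1.2 T hT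
  rw [Finset.mem_inter] at hf
  refine ⟨f, Finset.mem_inter.2 ⟨Finset.mem_erase.2 ⟨?_, hf.1⟩, hf.2⟩⟩
  rintro rfl
  exact hd (hT.1 _ hf.2)

/-- A member of a saturated blocker is the only possible common member with some
triangulation. -/
theorem IsSaturatedBlockerOn.exists_triangulationOn {n : ℕ} {S : Finset (ZMod n)}
    {B : Finset (Sym2 (ZMod n))} (hB : IsSaturatedBlockerOn n S B) {e : Sym2 (ZMod n)}
    (he : e ∈ B) : ∃ T, IsTriangulationOn n S T ∧ ∀ f ∈ B, f ≠ e → ∃ g ∈ T, Cross n f g := by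
  have h := hB.2 e he
  rw [IsBlockerOn] at h
  push Not at h
  obtain ⟨T, hT, hBT⟩ := h fun f hf => hB.1.1 f (Finset.mem_of_mem_erase hf)
  refine ⟨T, hT, fun f hf hfe => hT.2.2 f (hB.isDiagonalOn hf) fun hfT => ?_⟩
  have : f ∈ B.erase e ∩ T := Finset.mem_inter.2 ⟨Finset.mem_erase.2 ⟨hfe, hf⟩, hfT⟩
  simp [hBT] at this

/-- If every member of a triangulation crossing a diagonal of the sub-polygon on `S` is itself a
diagonal of that sub-polygon, then the triangulation meets every blocker of the sub-polygon. -/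
theorem IsTriangulation.inter_nonempty_of_isBlockerOn {n : ℕ} {S : Finset (ZMod n)}
    {T B : Finset (Sym2 (ZMod n))} (hT : IsTriangulation n T) (hB : IsBlockerOn n S B)
    (hS : ∀ e, IsDiagonalOn n S e → ∀ f ∈ T, Cross n e f → IsDiagonalOn n S f) :
    (B ∩ T).Nonempty := by
  classical
  obtain ⟨f, hf⟩ := hB.2 (T.filter (IsDiagonalOn n S)) ⟨by simp, by
    simp only [Finset.mem_filter]
    exact fun e he f hf => hT.2.1 e he.1 f hf.1, by
    intro e he heT
    obtain ⟨x, y, rfl, -, -, hxy, ⟨u, -, hu⟩, ⟨v, -, hv⟩⟩ := id he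
    obtain ⟨f, hf, hc⟩ := hT.2.2 _ ⟨x, y, rfl, hxy, ⟨u, hu⟩, ⟨v, hv⟩⟩
      fun h => heT (Finset.mem_filter.2 ⟨h, he⟩)
    exact ⟨f, Finset.mem_filter.2 ⟨hf, hS _ he f hf hc⟩, hc⟩⟩
  simp only [Finset.mem_inter, Finset.mem_filter] at hf
  exact ⟨f, Finset.mem_inter.2 ⟨hf.1, hf.2.1⟩⟩

theorem cast_mem_image_cast_iff {n x p q : ℕ} (hx : x < n) (hq : q ≤ n) :
    (x : ZMod n) ∈ (Finset.Ico p q).image (fun j : ℕ => (j : ZMod n)) ↔ p ≤ x ∧ x < q := by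
  simp only [Finset.mem_image, Finset.mem_Ico]
  constructor
  · rintro ⟨j, hj, h⟩
    rw [cast_inj_of_lt (by omega) hx] at h
    omega
  · exact fun h => ⟨x, h, rfl⟩

theorem cast_mem_wrapping_arc_iff {n c x : ℕ} (hcn : c < n) (hx : x < n) :
    (x : ZMod n) ∈ (Finset.Ico c n).image (fun j : ℕ => (j : ZMod n)) ∪
      {(0 : ZMod n), ((c - 1 : ℕ) : ZMod n)} ↔ x = 0 ∨ c - 1 ≤ x := by
  rw [Finset.mem_union, cast_mem_image_cast_iff hx le_rfl, Finset.mem_insert,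
    Finset.mem_singleton, cast_inj_of_lt hx (by omega), ← Nat.cast_zero,
    cast_inj_of_lt hx (by omega)]
  omega

theorem cast_mem_arc_iff {n a b x : ℕ} (hab : a ≤ b) (hb : b < n) (hx : x < n) :
    (x : ZMod n) ∈ (Finset.Ico a b).image (fun j : ℕ => (j : ZMod n)) ∪
      {((a - 1 : ℕ) : ZMod n), (b : ZMod n)} ↔ a - 1 ≤ x ∧ x ≤ b := by
  rw [Finset.mem_union, cast_mem_image_cast_iff hx hb.le, Finset.mem_insert,
    Finset.mem_singleton, cast_inj_of_lt hx (by omega), cast_inj_of_lt hx hb]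
  omega

theorem isDiagonalOn_wrapping_arc_iff {n c x y : ℕ} (hc : 1 < c) (hcn : c < n) (hxy : x < y)
    (hy : y < n) :
    IsDiagonalOn n ((Finset.Ico c n).image (fun j : ℕ => (j : ZMod n)) ∪
      {(0 : ZMod n), ((c - 1 : ℕ) : ZMod n)}) (chord n x y) ↔
      (x = 0 ∧ c ≤ y ∧ y + 2 ≤ n) ∨ (c - 1 ≤ x ∧ x + 2 ≤ y) := by
  rw [isDiagonalOn_chord_iff hxy hy, cast_mem_wrapping_arc_iff hcn (hxy.trans hy),
    cast_mem_wrapping_arc_iff hcn hy]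
  constructor
  · rintro ⟨hx', hy', ⟨u, hu, hub⟩, ⟨v, hvn, hv, hvb⟩⟩
    rw [cast_mem_wrapping_arc_iff hcn (by omega)] at hu
    rw [cast_mem_wrapping_arc_iff hcn hvn] at hv
    omega
  · rintro (h | h)
    · refine ⟨by omega, by omega, ⟨c - 1, ?_, by omega⟩, ⟨n - 1, by omega, ?_, by omega⟩⟩ <;>
      rw [cast_mem_wrapping_arc_iff hcn (by omega)] <;> omega
    · refine ⟨by omega, by omega, ⟨x + 1, ?_, by omega⟩, ⟨0, by omega, ?_, by omega⟩⟩ <;>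
      rw [cast_mem_wrapping_arc_iff hcn (by omega)] <;> omega

theorem isDiagonalOn_arc_iff {n a b x y : ℕ} (hab : a ≤ b) (hb : b < n) (hxy : x < y)
    (hy : y < n) :
    IsDiagonalOn n ((Finset.Ico a b).image (fun j : ℕ => (j : ZMod n)) ∪
      {((a - 1 : ℕ) : ZMod n), (b : ZMod n)}) (chord n x y) ↔
      a - 1 ≤ x ∧ x + 2 ≤ y ∧ y ≤ b ∧ ¬ (x = a - 1 ∧ y = b) := by
  rw [isDiagonalOn_chord_iff hxy hy, cast_mem_arc_iff hab hb (hxy.trans hy),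
    cast_mem_arc_iff hab hb hy]
  constructor
  · rintro ⟨hx', hy', ⟨u, hu, hub⟩, ⟨v, hvn, hv, hvb⟩⟩
    rw [cast_mem_arc_iff hab hb (by omega)] at hu
    rw [cast_mem_arc_iff hab hb hvn] at hv
    omega
  · intro h
    refine ⟨by omega, by omega, ⟨x + 1, ?_, by omega⟩, ?_⟩
    · rw [cast_mem_arc_iff hab hb (by omega)]
      omega
    · by_cases hx : x = a - 1
      · refine ⟨b, hb, ?_, by omega⟩
        rw [cast_mem_arc_iff hab hb hb]
        omega
      · refine ⟨a - 1, by omega, ?_, by omega⟩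
        rw [cast_mem_arc_iff hab hb (by omega)]
        omega

theorem chord_mem_image_product_iff {n x y p q r s : ℕ} (hx : x < n) (hy : y < n)
    (hq : q ≤ n) (hs : s ≤ n) :
    chord n x y ∈ (Finset.Ico p q ×ˢ Finset.Ico r s).image
        (fun t => s((t.1 : ZMod n), (t.2 : ZMod n))) ↔
      (p ≤ x ∧ x < q ∧ r ≤ y ∧ y < s) ∨ (p ≤ y ∧ y < q ∧ r ≤ x ∧ x < s) := by
  simp only [Finset.mem_image, Finset.mem_product, Finset.mem_Ico, Prod.exists]
  constructor
  · rintro ⟨u, v, h, he⟩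
    rw [← chord, chord_eq_iff (by omega) (by omega) hx hy] at he
    omega
  · rintro (h | h)
    · exact ⟨x, y, by omega, rfl⟩
    · exact ⟨y, x, by omega, chord_comm n y x⟩

theorem card_image_product {n p q r s : ℕ} (hq : q ≤ n) (hs : s ≤ n)
    (h : q ≤ r ∨ s ≤ p) :
    ((Finset.Ico p q ×ˢ Finset.Ico r s).image
      (fun t => s((t.1 : ZMod n), (t.2 : ZMod n)))).card = (q - p) * (s - r) := by
  rw [Finset.card_image_of_injOn, Finset.card_product, Nat.card_Ico, Nat.card_Ico]
  rintro ⟨u, v⟩ huv ⟨w, z⟩ hwz he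
  simp only [Finset.coe_product, Finset.coe_Ico, Set.mem_prod, Set.mem_Ico] at huv hwz
  change chord n u v = chord n w z at he
  rw [chord_eq_iff (by omega) (by omega) (by omega) (by omega)] at he
  rw [Prod.mk.injEq]
  omega

end ConvexBlocker

set_option maxHeartbeats 2000000 in
open ConvexBlocker in
/-- replacing the two edges `{0,c-1}` and `{a-1,b}` of the quadrilateral blocker
`B_Q` by saturated blockers `B_T`, `B_B` of the sub-polygons on `V_T ∪ {0,c-1}` and
`V_B ∪ {a-1,b}` yields a saturated blocker `B_M` of the convex `n`-gon with exactly
`|V_T|·|V_B| + |V_L|·|V_R| + |B_T| + |B_B| - 2` edges. -/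
theorem matrioshka_blocker
    (n a b c : ℕ) (hn : 4 ≤ n) (ha : 0 < a) (hab : a < b) (hbc : b < c) (hc : c ≤ n - 1)
    (hL : 3 ≤ c - b) (hR : 3 ≤ a) (hT : 2 ≤ n - c) (hBarc : 2 ≤ b - a)
    (BQ : Finset (Sym2 (ZMod n)))
    (hBQ : BQ =
      ((Finset.range a ×ˢ Finset.Ico b c).image
        (fun p => s((p.1 : ZMod n), (p.2 : ZMod n)))) ∪
      ((Finset.Ico c n ×ˢ Finset.Ico a b).image
        (fun p => s((p.1 : ZMod n), (p.2 : ZMod n)))))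
    (ST SB : Finset (ZMod n))
    (hST : ST = (Finset.Ico c n).image (fun j : ℕ => (j : ZMod n)) ∪
      {(0 : ZMod n), ((c - 1 : ℕ) : ZMod n)})
    (hSB : SB = (Finset.Ico a b).image (fun j : ℕ => (j : ZMod n)) ∪
      {((a - 1 : ℕ) : ZMod n), ((b : ℕ) : ZMod n)})
    (BT BB : Finset (Sym2 (ZMod n)))
    (hBT : IsSaturatedBlockerOn n ST BT) (hBB : IsSaturatedBlockerOn n SB BB)
    (BM : Finset (Sym2 (ZMod n)))
    (hBM : BM = (BQ \ {s((0 : ZMod n), ((c - 1 : ℕ) : ZMod n)),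
                        s(((a - 1 : ℕ) : ZMod n), ((b : ℕ) : ZMod n))}) ∪ BT ∪ BB) :
    IsSaturatedBlocker n BM ∧
      BM.card = (n - c) * (b - a) + (c - b) * a + BT.card + BB.card - 2 := by
  classical
  have : NeZero n := ⟨by omega⟩
  have hcn : c < n := by omega
  have hbn : b < n := by omega
  have hdT : ∀ {x y}, x < y → y < n → (IsDiagonalOn n ST (chord n x y) ↔
      (x = 0 ∧ c ≤ y ∧ y + 2 ≤ n) ∨ (c - 1 ≤ x ∧ x + 2 ≤ y)) := by
    intro x y hxy hy
    rw [hST]; exact isDiagonalOn_wrapping_arc_iff (by omega) hcn hxy hy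
  have hdB : ∀ {x y}, x < y → y < n → (IsDiagonalOn n SB (chord n x y) ↔
      a - 1 ≤ x ∧ x + 2 ≤ y ∧ y ≤ b ∧ ¬ (x = a - 1 ∧ y = b)) := by
    intro x y hxy hy
    rw [hSB]; exact isDiagonalOn_arc_iff hab.le hbn hxy hy
  have hmemT : ∀ {x y}, x < y → y < n → chord n x y ∈ BT →
      (x = 0 ∧ c ≤ y ∧ y + 2 ≤ n) ∨ (c - 1 ≤ x ∧ x + 2 ≤ y) :=
    fun hxy hy h => (hdT hxy hy).1 (hBT.isDiagonalOn h)
  have hmemB : ∀ {x y}, x < y → y < n → chord n x y ∈ BB →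
      a - 1 ≤ x ∧ x + 2 ≤ y ∧ y ≤ b ∧ ¬ (x = a - 1 ∧ y = b) :=
    fun hxy hy h => (hdB hxy hy).1 (hBB.isDiagonalOn h)
  have hmemQ : ∀ {x y}, x < y → y < n → (chord n x y ∈ BQ ↔
      (x < a ∧ b ≤ y ∧ y < c) ∨ (a ≤ x ∧ x < b ∧ c ≤ y)) := by
    intro x y hxy hy
    rw [hBQ, Finset.mem_union, Finset.range_eq_Ico,
      chord_mem_image_product_iff (by omega) hy (by omega) (by omega),
      chord_mem_image_product_iff (by omega) hy (by omega) (by omega)]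
    omega
  rw [← Nat.cast_zero (R := ZMod n), ← chord, ← chord] at hBM
  have hmem : ∀ {x y}, x < y → y < n → (chord n x y ∈ BM ↔
      ((x < a ∧ b ≤ y ∧ y < c ∧ ¬ (x = 0 ∧ y = c - 1) ∧ ¬ (x = a - 1 ∧ y = b)) ∨
        (a ≤ x ∧ x < b ∧ c ≤ y)) ∨ chord n x y ∈ BT ∨ chord n x y ∈ BB) := by
    intro x y hxy hy
    rw [hBM, Finset.mem_union, Finset.mem_union, Finset.mem_sdiff, Finset.mem_insert,
      Finset.mem_singleton, chord_eq_iff (by omega) hy (by omega) (by omega),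
      chord_eq_iff (by omega) hy (by omega) (by omega), hmemQ hxy hy, or_assoc]
    refine or_congr_left ?_
    omega
  have hedge : ∀ e ∈ BM, IsEdge n e := by
    intro e he
    rw [hBM, Finset.mem_union, Finset.mem_union, Finset.mem_sdiff, hBQ] at he
    rcases he with (⟨he, -⟩ | he) | he
    · simp only [Finset.mem_union, Finset.mem_image, Finset.mem_product, Finset.mem_Ico,
        Finset.mem_range, Prod.exists] at he
      rcases he with ⟨p, q, h, rfl⟩ | ⟨p, q, h, rfl⟩
      · exact isEdge_chord (by omega) (by omega)
      · rw [Sym2.eq_swap]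
        exact isEdge_chord (by omega) (by omega)
    · obtain ⟨x, y, h, -, -, hxy⟩ := hBT.1.1 e he
      exact ⟨x, y, h, hxy⟩
    · obtain ⟨x, y, h, -, -, hxy⟩ := hBB.1.1 e he
      exact ⟨x, y, h, hxy⟩
  have hTM : BT ⊆ BM := by
    rw [hBM]
    exact Finset.subset_union_right.trans Finset.subset_union_left
  have hBBM : BB ⊆ BM := by
    rw [hBM]
    exact Finset.subset_union_right
  refine ⟨⟨⟨hedge, ?_⟩, ?_⟩, ?_⟩
  · intro T hT
    by_cases hT₀ : chord n 0 (c - 1) ∈ T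
    · refine (hT.inter_nonempty_of_isBlockerOn hBT.1 ?_).mono
        (Finset.inter_subset_inter_right hTM)
      intro e he f hf hcr
      obtain ⟨x, y, hxy, hy, rfl⟩ := he.exists_lt
      obtain ⟨r, s, hrs, hs, rfl⟩ := (hT.1 f hf).exists_lt
      have hno := hT.2.1 _ hT₀ _ hf
      rw [cross_chord_iff (by omega) (by omega) hrs hs] at hno
      rw [cross_chord_iff hxy hy hrs hs] at hcr
      rw [hdT hxy hy] at he
      rw [hdT hrs hs]
      omega
    by_cases hT₁ : chord n (a - 1) b ∈ T
    · refine (hT.inter_nonempty_of_isBlockerOn hBB.1 ?_).mono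
        (Finset.inter_subset_inter_right hBBM)
      intro e he f hf hcr
      obtain ⟨x, y, hxy, hy, rfl⟩ := he.exists_lt
      obtain ⟨r, s, hrs, hs, rfl⟩ := (hT.1 f hf).exists_lt
      have hno := hT.2.1 _ hT₁ _ hf
      rw [cross_chord_iff (by omega) (by omega) hrs hs] at hno
      rw [cross_chord_iff hxy hy hrs hs] at hcr
      rw [hdB hxy hy] at he
      rw [hdB hrs hs]
      omega
    rcases hT.exists_chord_opposite_arcs ha hab hbc hcn with
      ⟨p, q, hp, hbq, hqc, h⟩ | ⟨p, q, hap, hpb, hcq, hq, h⟩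
    · refine ⟨chord n p q, Finset.mem_inter.2 ⟨(hmem (by omega) (by omega)).2 ?_, h⟩⟩
      refine Or.inl (Or.inl ⟨hp, hbq, hqc, ?_, ?_⟩)
      · rintro ⟨rfl, rfl⟩; exact hT₀ h
      · rintro ⟨rfl, rfl⟩; exact hT₁ h
    · exact ⟨chord n p q, Finset.mem_inter.2
        ⟨(hmem (by omega) (by omega)).2 (Or.inl (Or.inr ⟨hap, hpb, hcq⟩)), h⟩⟩
  · intro e he
    obtain ⟨i, j, hij, hj, rfl⟩ := (hedge e he).exists_lt
    rw [hmem hij hj] at he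
    have hother : ∀ {x y}, x < y → y < n → chord n x y ∈ BM.erase (chord n i j) →
        ¬ (x = i ∧ y = j) ∧ chord n x y ≠ chord n i j ∧ (((x < a ∧ b ≤ y ∧ y < c ∧
        ¬ (x = 0 ∧ y = c - 1) ∧ ¬ (x = a - 1 ∧ y = b)) ∨ (a ≤ x ∧ x < b ∧ c ≤ y)) ∨
        chord n x y ∈ BT ∨ chord n x y ∈ BB) := by
      intro x y hxy hy h
      rw [Finset.mem_erase, hmem hxy hy] at h
      refine ⟨?_, h⟩
      rintro ⟨rfl, rfl⟩
      exact h.1 rfl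
    rcases he with (he | he) | he | he
    · apply not_isBlocker_of_crossed fun p q =>
        (p = i ∧ q = j) ∨ (p = j ∧ q = c) ∨ (i ≠ 0 ∧ p = i ∧ c ≤ q) ∨ (i = 0 ∧ p = j ∧ c ≤ q) ∨
        (p = b - 1 ∧ q = j) ∨ (i ≠ a - 1 ∧ p = i ∧ a ≤ q ∧ q < b) ∨
        (i = a - 1 ∧ a ≤ p ∧ p < b ∧ q = j)
      · omega
      · intro x y hxy hy h
        obtain ⟨hne, -, (h | h) | h | h⟩ := hother hxy hy h
        · by_cases hcr : (x < i ∧ y < j) ∨ (i < x ∧ j < y)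
          · exact ⟨i, j, by omega⟩
          by_cases hjy : j < y
          · exact ⟨j, c, by omega⟩
          by_cases hyj : y < j
          · exact ⟨b - 1, j, by omega⟩
          by_cases hxi : x < i
          · exact ⟨i, n - 1, by omega⟩
          · exact ⟨i, a, by omega⟩
        · exact ⟨i, j, by omega⟩
        · have := hmemT hxy hy h
          by_cases hi : i = 0 <;> by_cases hx : x = 0
          · exact ⟨j, y + 1, by omega⟩
          · exact ⟨j, x + 1, by omega⟩
          · exact ⟨i, y + 1, by omega⟩
          · exact ⟨i, x + 1, by omega⟩
        · have := hmemB hxy hy h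
          by_cases hi : i = a - 1
          · exact ⟨x + 1, j, by omega⟩
          · exact ⟨i, x + 1, by omega⟩
    · apply not_isBlocker_of_crossed fun p q =>
        (p = i ∧ q = j) ∨ (p = 1 ∧ (q ≤ i ∨ j ≤ q)) ∨ (i ≤ p ∧ q = b + 1) ∨
        (p = b + 1 ∧ q ≤ j)
      · omega
      · intro x y hxy hy h
        obtain ⟨hne, -, (h | h) | h | h⟩ := hother hxy hy h
        · exact ⟨i, j, by omega⟩
        · by_cases hcr : (x < i ∧ y < j) ∨ (i < x ∧ j < y)
          · exact ⟨i, j, by omega⟩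
          by_cases hxi : x < i
          · exact ⟨1, i, by omega⟩
          by_cases hix : i < x
          · exact ⟨i, b + 1, by omega⟩
          by_cases hjy : j < y
          · exact ⟨1, j, by omega⟩
          · exact ⟨b + 1, j, by omega⟩
        · have := hmemT hxy hy h
          obtain ⟨m, hcm, hmn, hm⟩ : ∃ m, c ≤ m ∧ m < n ∧
              ((x = 0 ∧ c ≤ y ∧ y < m) ∨ (c - 1 ≤ x ∧ x < m ∧ m < y)) := by
            by_cases hx : x = 0
            · exact ⟨y + 1, by omega⟩
            · exact ⟨x + 1, by omega⟩
          by_cases hjm : j ≤ m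
          · exact ⟨1, m, by omega⟩
          · exact ⟨b + 1, m, by omega⟩
        · have := hmemB hxy hy h
          by_cases hxi : x + 1 ≤ i
          · exact ⟨1, x + 1, by omega⟩
          · exact ⟨x + 1, b + 1, by omega⟩
    · obtain ⟨T, hT, hTB⟩ := hBT.exists_triangulationOn he
      apply not_isBlocker_of_crossed fun p q => (p < q ∧ q < n ∧ chord n p q ∈ T) ∨
        (p = 0 ∧ q = c - 1) ∨ (p = 0 ∧ a ≤ q ∧ q < b) ∨ (p = b - 1 ∧ q = c - 1)
      · rintro p q r s hpr hrq hqs hs (⟨hpq, hq, h⟩ | h) (⟨hrs, -, h'⟩ | h')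
        · exact hT.2.1 _ h _ h' ((cross_chord_iff hpq hq hrs hs).2 (by omega))
        · have := (hdT hpq hq).1 (hT.1 _ h); omega
        · have := (hdT hrs hs).1 (hT.1 _ h'); omega
        · omega
      · intro x y hxy hy h
        obtain ⟨-, hne, (h | h) | h | h⟩ := hother hxy hy h
        · by_cases hx : x = 0
          · exact ⟨b - 1, c - 1, by omega⟩
          · exact ⟨0, a, by omega⟩
        · exact ⟨0, c - 1, by omega⟩
        · obtain ⟨g, hg, hcr⟩ := hTB _ h hne
          obtain ⟨p, q, hpq, hq, rfl⟩ := (hT.1 g hg).exists_lt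
          rw [cross_chord_iff hxy hy hpq hq] at hcr
          exact ⟨p, q, hpq, hq, Or.inl ⟨hpq, hq, hg⟩, hcr⟩
        · have := hmemB hxy hy h
          exact ⟨0, x + 1, by omega⟩
    · obtain ⟨T, hT, hTB⟩ := hBB.exists_triangulationOn he
      apply not_isBlocker_of_crossed fun p q => (p < q ∧ q < n ∧ chord n p q ∈ T) ∨
        (p = a - 1 ∧ q = b) ∨ (p = a - 1 ∧ c ≤ q) ∨ (p = b ∧ q = c)
      · rintro p q r s hpr hrq hqs hs (⟨hpq, hq, h⟩ | h) (⟨hrs, -, h'⟩ | h')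
        · exact hT.2.1 _ h _ h' ((cross_chord_iff hpq hq hrs hs).2 (by omega))
        · have := (hdB hpq hq).1 (hT.1 _ h); omega
        · have := (hdB hrs hs).1 (hT.1 _ h'); omega
        · omega
      · intro x y hxy hy h
        obtain ⟨-, hne, (h | h) | h | h⟩ := hother hxy hy h
        · by_cases hx : x = a - 1
          · exact ⟨b, c, by omega⟩
          · exact ⟨a - 1, n - 1, by omega⟩
        · exact ⟨a - 1, b, by omega⟩
        · have := hmemT hxy hy h
          by_cases hx : x = 0
          · exact ⟨a - 1, y + 1, by omega⟩
          · exact ⟨a - 1, x + 1, by omega⟩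
        · obtain ⟨g, hg, hcr⟩ := hTB _ h hne
          obtain ⟨p, q, hpq, hq, rfl⟩ := (hT.1 g hg).exists_lt
          rw [cross_chord_iff hxy hy hpq hq] at hcr
          exact ⟨p, q, hpq, hq, Or.inl ⟨hpq, hq, hg⟩, hcr⟩
  · have hpair : ({chord n 0 (c - 1), chord n (a - 1) b} : Finset (Sym2 (ZMod n))) ⊆ BQ := by
      rw [Finset.insert_subset_iff, Finset.singleton_subset_iff,
        hmemQ (by omega) (by omega), hmemQ (by omega) hbn]
      omega
    have hpair_card :
        ({chord n 0 (c - 1), chord n (a - 1) b} : Finset (Sym2 (ZMod n))).card = 2 := by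
      rw [Finset.card_pair]
      rw [Ne, chord_eq_iff (by omega) (by omega) (by omega) hbn]
      omega
    have hQ_card : BQ.card = a * (c - b) + (n - c) * (b - a) := by
      rw [hBQ, Finset.card_union_of_disjoint, Finset.range_eq_Ico,
        card_image_product (by omega) (by omega) (by omega),
        card_image_product (by omega) (by omega) (by omega), Nat.sub_zero]
      rw [Finset.disjoint_left]
      intro e he he'
      obtain ⟨x, y, hxy, hy, rfl⟩ := exists_chord_eq e
      rw [Finset.range_eq_Ico,
        chord_mem_image_product_iff (by omega) hy (by omega) (by omega)] at he
      rw [chord_mem_image_product_iff (by omega) hy (by omega) (by omega)] at he'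
      omega
    have hQT : Disjoint BQ BT := by
      rw [Finset.disjoint_left]
      intro e he he'
      obtain ⟨x, y, hxy, hy, rfl⟩ := (hBT.isDiagonalOn he').exists_lt
      have := hmemT hxy hy he'
      rw [hmemQ hxy hy] at he
      omega
    have hQB : Disjoint BQ BB := by
      rw [Finset.disjoint_left]
      intro e he he'
      obtain ⟨x, y, hxy, hy, rfl⟩ := (hBB.isDiagonalOn he').exists_lt
      have := hmemB hxy hy he'
      rw [hmemQ hxy hy] at he
      omega
    have hTB : Disjoint BT BB := by
      rw [Finset.disjoint_left]
      intro e he he'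
      obtain ⟨x, y, hxy, hy, rfl⟩ := (hBB.isDiagonalOn he').exists_lt
      have := hmemT hxy hy he
      have := hmemB hxy hy he'
      omega
    rw [hBM, Finset.card_union_of_disjoint (Finset.disjoint_union_left.2
        ⟨hQB.mono_left Finset.sdiff_subset, hTB⟩),
      Finset.card_union_of_disjoint (hQT.mono_left Finset.sdiff_subset),
      Finset.card_sdiff_of_subset hpair, hpair_card, hQ_card, mul_comm a]
    have : 0 < (c - b) * a := Nat.mul_pos (by omega) ha
    have : 0 < (n - c) * (b - a) := Nat.mul_pos (by omega) (by omega)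
    omega
end

section
/- For every integer n ≥ 5 and every integer t satisfying n − 2 ≤ t and 8t ≤ n² + 2n − 11 (i.e., t ≤ n²/8 + n/4 − 11/8), there exists a saturated blocker of the convex n-gon consisting of exactly t edges. -/
open Finset

namespace ConvexBlocker

/-- Two chords `{p, q}` and `{x, y}` (with `p ≤ q` and `x ≤ y`) interleave on the line. -/
def Interleave (p q x y : ℕ) : Prop :=
  (p < x ∧ x < q ∧ q < y) ∨ (x < p ∧ p < y ∧ y < q)

theorem val_sub_eq_ite {n : ℕ} [NeZero n] (a b : ZMod n) :
    (a - b).val = if b.val ≤ a.val then a.val - b.val else n + a.val - b.val := by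
  split_ifs with h
  · exact ZMod.val_sub h
  · have hb := ZMod.val_lt b
    have hcast : a - b = ((n + a.val - b.val : ℕ) : ZMod n) := by
      rw [Nat.cast_sub (by omega)]
      simp
    rw [hcast, ZMod.val_natCast_of_lt (by omega)]

theorem cross_mk_iff {n : ℕ} [NeZero n] {a b c d : ZMod n} (hab : a.val < b.val)
    (hcd : c.val < d.val) :
    Cross n s(a, b) s(c, d) ↔ Interleave a.val b.val c.val d.val := by
  have ha := ZMod.val_lt a
  have hb := ZMod.val_lt b
  have hc := ZMod.val_lt c
  have hd := ZMod.val_lt d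
  constructor
  · rintro ⟨a', b', c', d', h1, h2, h⟩
    rw [Sym2.eq_iff] at h1 h2
    simp only [val_sub_eq_ite] at h
    unfold Interleave
    rcases h1 with ⟨rfl, rfl⟩ | ⟨rfl, rfl⟩ <;> rcases h2 with ⟨rfl, rfl⟩ | ⟨rfl, rfl⟩ <;>
      split_ifs at h <;> omega
  · rintro (h | h)
    · refine ⟨a, b, c, d, rfl, rfl, ?_⟩
      simp only [val_sub_eq_ite]
      split_ifs <;> omega
    · refine ⟨b, a, c, d, Sym2.eq_swap, rfl, ?_⟩
      simp only [val_sub_eq_ite]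
      split_ifs <;> omega

theorem isDiagonal_mk_iff {n : ℕ} [NeZero n] {a b : ZMod n} (hab : a.val < b.val) :
    IsDiagonal n s(a, b) ↔ a.val + 2 ≤ b.val ∧ ¬ (a.val = 0 ∧ b.val = n - 1) := by
  have hb := ZMod.val_lt b
  constructor
  · rintro ⟨a', b', h1, -, ⟨c, hc⟩, ⟨d, hd⟩⟩
    have hcn := ZMod.val_lt c
    have hdn := ZMod.val_lt d
    simp only [Btw, val_sub_eq_ite] at hc hd
    rw [Sym2.eq_iff] at h1
    rcases h1 with ⟨rfl, rfl⟩ | ⟨rfl, rfl⟩ <;> split_ifs at hc hd <;> omega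
  · rintro ⟨h1, h2⟩
    refine ⟨a, b, rfl, fun h => by simp [h] at hab, ⟨((a.val + 1 : ℕ) : ZMod n), ?_⟩, ?_⟩
    · simp only [Btw, val_sub_eq_ite, ZMod.val_natCast_of_lt (show a.val + 1 < n by omega)]
      split_ifs <;> omega
    · by_cases h : b.val + 1 < n
      · refine ⟨((b.val + 1 : ℕ) : ZMod n), ?_⟩
        simp only [Btw, val_sub_eq_ite, ZMod.val_natCast_of_lt h]
        split_ifs <;> omega
      · refine ⟨0, ?_⟩
        simp only [Btw, val_sub_eq_ite, ZMod.val_zero]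
        split_ifs <;> omega

theorem IsDiagonal.exists_mk {n : ℕ} [NeZero n] {e : Sym2 (ZMod n)} (he : IsDiagonal n e) :
    ∃ a b : ZMod n, e = s(a, b) ∧ a.val < b.val := by
  obtain ⟨a, b, rfl, hab, -⟩ := he
  rcases lt_trichotomy a.val b.val with h | h | h
  · exact ⟨a, b, rfl, h⟩
  · exact absurd (ZMod.val_injective n h) hab
  · exact ⟨b, a, Sym2.eq_swap, h⟩

theorem cross_comm_of_isDiagonal {n : ℕ} [NeZero n] {e f : Sym2 (ZMod n)}
    (he : IsDiagonal n e) (hf : IsDiagonal n f) (h : Cross n e f) : Cross n f e := by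
  obtain ⟨a, b, rfl, hab⟩ := he.exists_mk
  obtain ⟨c, d, rfl, hcd⟩ := hf.exists_mk
  rw [cross_mk_iff hab hcd] at h
  rw [cross_mk_iff hcd hab]
  unfold Interleave at *
  omega

theorem not_cross_self {n : ℕ} [NeZero n] {e : Sym2 (ZMod n)} (he : IsDiagonal n e) :
    ¬ Cross n e e := by
  obtain ⟨a, b, rfl, hab⟩ := he.exists_mk
  rw [cross_mk_iff hab hab]
  unfold Interleave
  omega

/-- Every set of pairwise non-crossing diagonals extends to a triangulation. -/
theorem exists_isTriangulation_superset {n : ℕ} [NeZero n] (T₀ : Finset (Sym2 (ZMod n)))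
    (hdiag : ∀ e ∈ T₀, IsDiagonal n e) (hcross : ∀ e ∈ T₀, ∀ f ∈ T₀, ¬ Cross n e f) :
    ∃ T, IsTriangulation n T ∧ T₀ ⊆ T := by
  classical
  let F : Finset (Finset (Sym2 (ZMod n))) := Finset.univ.filter fun T =>
    T₀ ⊆ T ∧ (∀ e ∈ T, IsDiagonal n e) ∧ ∀ e ∈ T, ∀ f ∈ T, ¬ Cross n e f
  obtain ⟨T, hTF, hmax⟩ := F.exists_max_image Finset.card
    ⟨T₀, by simpa [F] using ⟨hdiag, hcross⟩⟩
  simp only [F, Finset.mem_filter, Finset.mem_univ, true_and] at hTF hmax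
  obtain ⟨hsub, hd, hc⟩ := hTF
  refine ⟨T, ⟨hd, hc, fun e he heT => ?_⟩, hsub⟩
  by_contra! hno
  have hle := hmax (insert e T) ⟨hsub.trans (Finset.subset_insert _ _), ?_, ?_⟩
  · rw [Finset.card_insert_of_notMem heT] at hle
    omega
  · intro f hf
    rcases Finset.mem_insert.1 hf with rfl | hf
    exacts [he, hd f hf]
  · intro f hf g hg
    rcases Finset.mem_insert.1 hf with rfl | hf <;> rcases Finset.mem_insert.1 hg with rfl | hg
    · exact not_cross_self he
    · exact hno g hg
    · exact fun h => hno f ‹_› (cross_comm_of_isDiagonal (hd f ‹_›) he h)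
    · exact hc f hf g hg

/-- The chord `{i, j}` is a boundary edge of the polygon or belongs to `T`. -/
def Side (n : ℕ) (T : Finset (Sym2 (ZMod n))) (i j : ℕ) : Prop :=
  j = i + 1 ∨ (i = 0 ∧ j = n - 1) ∨ s((i : ZMod n), (j : ZMod n)) ∈ T

/-- Every side of a triangulation is the base of a triangle, on the side of the arc from `i`
to `j`. -/
theorem IsTriangulation.exists_apex {n : ℕ} [NeZero n] {T : Finset (Sym2 (ZMod n))}
    (hT : IsTriangulation n T) {i j : ℕ} (hij : i + 2 ≤ j) (hj : j < n) (h : Side n T i j) :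
    ∃ c, i < c ∧ c < j ∧ Side n T i c ∧ Side n T c j := by
  classical
  obtain ⟨c, hc, hmax⟩ := ((Finset.Ioo i j).filter fun c => Side n T i c).exists_max_image id
    ⟨i + 1, Finset.mem_filter.2 ⟨Finset.mem_Ioo.2 (by omega), Or.inl rfl⟩⟩
  simp only [Finset.mem_filter, Finset.mem_Ioo, id, and_imp] at hc hmax
  obtain ⟨⟨hic, hcj⟩, hside⟩ := hc
  refine ⟨c, hic, hcj, hside, ?_⟩
  have vi : ((i : ℕ) : ZMod n).val = i := ZMod.val_natCast_of_lt (by omega)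
  have vj : ((j : ℕ) : ZMod n).val = j := ZMod.val_natCast_of_lt hj
  have vc : ((c : ℕ) : ZMod n).val = c := ZMod.val_natCast_of_lt (by omega)
  by_contra hno
  simp only [Side, not_or] at hno
  obtain ⟨f, hfT, hf⟩ := hT.2.2 s((c : ZMod n), (j : ZMod n))
    ((isDiagonal_mk_iff (by omega)).2 (by omega)) hno.2.2
  obtain ⟨x, y, rfl, hxy⟩ := (hT.1 f hfT).exists_mk
  rw [cross_mk_iff (by omega) hxy, vc, vj] at hf
  have hyn := ZMod.val_lt y
  have h_side : ∀ k, i < k → k < n → Side n T i k →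
      k = i + 1 ∨ (i = 0 ∧ k = n - 1) ∨ ¬ Interleave i k x.val y.val := by
    intro k hk hkn hs
    refine hs.imp_right (Or.imp_right fun hmem hcr => ?_)
    have vk : ((k : ℕ) : ZMod n).val = k := ZMod.val_natCast_of_lt hkn
    refine hT.2.1 _ hmem _ hfT ((cross_mk_iff (by omega) hxy).2 ?_)
    rwa [vi, vk]
  have hj_side := h_side j (by omega) hj h
  have hc_side := h_side c hic (by omega) hside
  unfold Interleave at *
  by_cases hxi : x.val = i
  · have hy_side : Side n T i y.val := by
      right; right
      rw [← hxi, ZMod.natCast_zmod_val, ZMod.natCast_zmod_val]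
      exact hfT
    rcases hf with hf | hf
    · omega
    · have := hmax y.val (by omega) (by omega) hy_side
      omega
  · omega

/-- The set of chords of the `n`-gon given by a set of pairs of natural numbers. -/
def chords (n : ℕ) (S : Finset (ℕ × ℕ)) : Finset (Sym2 (ZMod n)) :=
  S.image fun p => s((p.1 : ZMod n), (p.2 : ZMod n))

theorem chord_injective {n : ℕ} {p q : ℕ × ℕ} (hp : p.1 < p.2 ∧ p.2 < n)
    (hq : q.1 < q.2 ∧ q.2 < n)
    (h : s((p.1 : ZMod n), (p.2 : ZMod n)) = s((q.1 : ZMod n), (q.2 : ZMod n))) : p = q := by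
  have hinj : ∀ {x y : ℕ}, x < n → y < n → (x : ZMod n) = y → x = y := by
    intro x y hx hy hxy
    have := congrArg ZMod.val hxy
    rwa [ZMod.val_natCast_of_lt hx, ZMod.val_natCast_of_lt hy] at this
  rw [Sym2.eq_iff] at h
  rcases h with ⟨h1, h2⟩ | ⟨h1, h2⟩
  · exact Prod.ext (hinj (by omega) (by omega) h1) (hinj (by omega) (by omega) h2)
  · have := hinj (by omega) (by omega) h1
    have := hinj (by omega) (by omega) h2
    omega

theorem card_chords {n : ℕ} {S : Finset (ℕ × ℕ)} (hS : ∀ p ∈ S, p.1 < p.2 ∧ p.2 < n) :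
    (chords n S).card = S.card :=
  Finset.card_image_of_injOn fun p hp q hq h => chord_injective (hS p hp) (hS q hq) h

/-- If non-crossing chords `L` together cross all members of `S` except `p`, then `S` without
`p` is not a blocker. -/
theorem not_isBlocker_erase {n : ℕ} [NeZero n] {S : Finset (ℕ × ℕ)}
    (hS : ∀ p ∈ S, p.1 < p.2 ∧ p.2 < n) (p : ℕ × ℕ) (L : Finset (ℕ × ℕ))
    (hL : ∀ q ∈ L, q.2 < n)
    (hLL : ∀ q ∈ L, ∀ q' ∈ L, ¬ Interleave q.1 q.2 q'.1 q'.2)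
    (hLS : ∀ p' ∈ S, p' ≠ p → ∃ q ∈ L, q.1 < q.2 ∧ Interleave p'.1 p'.2 q.1 q.2) :
    ¬ IsBlocker n ((chords n S).erase s((p.1 : ZMod n), (p.2 : ZMod n))) := by
  intro hB
  have val_eq : ∀ {x : ℕ}, x < n → ((x : ℕ) : ZMod n).val = x := ZMod.val_natCast_of_lt
  let L' := L.filter fun q => q.1 + 2 ≤ q.2 ∧ ¬ (q.1 = 0 ∧ q.2 = n - 1)
  obtain ⟨T, hT, hsub⟩ := exists_isTriangulation_superset (chords n L') (by
    intro e he
    obtain ⟨q, hq, rfl⟩ := Finset.mem_image.1 he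
    obtain ⟨hqL, hq'⟩ := Finset.mem_filter.1 hq
    have := hL q hqL
    rw [isDiagonal_mk_iff] <;> rw [val_eq (by omega), val_eq (by omega)] <;> omega) (by
    intro e he f hf
    obtain ⟨q, hq, rfl⟩ := Finset.mem_image.1 he
    obtain ⟨r, hr, rfl⟩ := Finset.mem_image.1 hf
    obtain ⟨hqL, hq'⟩ := Finset.mem_filter.1 hq
    obtain ⟨hrL, hr'⟩ := Finset.mem_filter.1 hr
    have := hL q hqL
    have := hL r hrL
    rw [cross_mk_iff (by rw [val_eq, val_eq] <;> omega) (by rw [val_eq, val_eq] <;> omega),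
      val_eq (by omega), val_eq (by omega), val_eq (by omega), val_eq (by omega)]
    exact hLL q hqL r hrL)
  obtain ⟨e, he⟩ := hB.2 T hT
  obtain ⟨heB, heT⟩ := Finset.mem_inter.1 he
  obtain ⟨hne, heS⟩ := Finset.mem_erase.1 heB
  obtain ⟨p', hp', rfl⟩ := Finset.mem_image.1 heS
  obtain ⟨q, hq, hlt, hcr⟩ := hLS p' hp' (by rintro rfl; exact hne rfl)
  have h1 := hS p' hp'
  have h2 := hL q hq
  refine hT.2.1 _ heT _ (hsub (Finset.mem_image_of_mem _ (Finset.mem_filter.2 ⟨hq, ?_⟩))) ?_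
  · unfold Interleave at hcr
    omega
  · rw [cross_mk_iff (by rw [val_eq, val_eq] <;> omega) (by rw [val_eq, val_eq] <;> omega),
      val_eq (by omega), val_eq (by omega), val_eq (by omega), val_eq (by omega)]
    exact hcr

/-- A purely combinatorial criterion for a set of chords to be a saturated blocker. -/
theorem isSaturatedBlocker_chords {n : ℕ} (hn : 3 ≤ n) {S : Finset (ℕ × ℕ)}
    (hS : ∀ p ∈ S, p.1 + 2 ≤ p.2 ∧ p.2 < n ∧ ¬ (p.1 = 0 ∧ p.2 = n - 1))
    (hblock : ∀ E : ℕ → ℕ → Prop, E 0 (n - 1) →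
      (∀ i j, i + 2 ≤ j → j < n → E i j → ∃ c, i < c ∧ c < j ∧ E i c ∧ E c j) →
      ∃ p ∈ S, E p.1 p.2)
    (hcrit : ∀ p ∈ S, ∃ L : Finset (ℕ × ℕ), (∀ q ∈ L, q.2 < n) ∧
      (∀ q ∈ L, ∀ q' ∈ L, ¬ Interleave q.1 q.2 q'.1 q'.2) ∧
      ∀ p' ∈ S, p' ≠ p → ∃ q ∈ L, q.1 < q.2 ∧ Interleave p'.1 p'.2 q.1 q.2) :
    IsSaturatedBlocker n (chords n S) := by
  have : NeZero n := ⟨by omega⟩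
  have hS' : ∀ p ∈ S, p.1 < p.2 ∧ p.2 < n := fun p hp => by
    have := hS p hp
    omega
  refine ⟨⟨fun e he => ?_, fun T hT => ?_⟩, fun e he => ?_⟩
  · obtain ⟨p, hp, rfl⟩ := Finset.mem_image.1 he
    refine ⟨_, _, rfl, fun h => ?_⟩
    have h1 := congrArg ZMod.val h
    have h2 := hS' p hp
    rw [ZMod.val_natCast_of_lt (by omega), ZMod.val_natCast_of_lt (by omega)] at h1
    omega
  · obtain ⟨p, hp, hE⟩ := hblock (Side n T) (Or.inr (Or.inl ⟨rfl, rfl⟩))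
      fun i j hij hj h => hT.exists_apex hij hj h
    have h1 := hS p hp
    refine ⟨s((p.1 : ZMod n), (p.2 : ZMod n)),
      Finset.mem_inter.2 ⟨Finset.mem_image_of_mem _ hp, ?_⟩⟩
    rcases hE with h | h | h
    · omega
    · exact absurd h h1.2.2
    · exact h
  · obtain ⟨p, hp, rfl⟩ := Finset.mem_image.1 he
    obtain ⟨L, hL, hLL, hLS⟩ := hcrit p hp
    exact not_isBlocker_erase hS' p L hL hLL hLS

/-- All diagonals at one vertex, together with the diagonal cutting that vertex off, form a
saturated blocker. -/
theorem exists_isSaturatedBlocker_star {n : ℕ} (hn : 5 ≤ n) :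
    ∃ B, IsSaturatedBlocker n B ∧ B.card = n - 2 := by
  let S : Finset (ℕ × ℕ) := insert (1, n - 1) ((Finset.Icc 2 (n - 2)).image fun k => (0, k))
  have hmem : ∀ x y, (x, y) ∈ S ↔ (x = 1 ∧ y = n - 1) ∨ (x = 0 ∧ 2 ≤ y ∧ y ≤ n - 2) := by
    intro x y
    simp only [S, Finset.mem_insert, Finset.mem_image, Finset.mem_Icc, Prod.mk.injEq]
    constructor
    · rintro (h | ⟨k, hk, rfl, rfl⟩) <;> omega
    · rintro (h | ⟨rfl, h⟩)
      exacts [Or.inl h, Or.inr ⟨y, h, rfl, rfl⟩]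
  have hS : ∀ p ∈ S, p.1 + 2 ≤ p.2 ∧ p.2 < n ∧ ¬ (p.1 = 0 ∧ p.2 = n - 1) := by
    rintro ⟨x, y⟩ h
    rw [hmem] at h
    dsimp only
    omega
  refine ⟨chords n S, isSaturatedBlocker_chords (by omega) hS ?_ ?_, ?_⟩
  · intro E h0 hapex
    obtain ⟨c, hc0, hcn, h1, h2⟩ := hapex 0 (n - 1) (by omega) (by omega) h0
    by_cases hc : c = 1
    · exact ⟨(1, n - 1), (hmem _ _).2 (by omega), hc ▸ h2⟩
    · exact ⟨(0, c), (hmem _ _).2 (by omega), h1⟩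
  · rintro ⟨x, y⟩ h
    rw [hmem] at h
    refine ⟨if x = 1 then {(1, n - 1)} else {(0, y), (1, y), (y, n - 1)}, ?_⟩
    rcases h with ⟨rfl, rfl⟩ | ⟨rfl, h⟩ <;>
      simp only [↓reduceIte, zero_ne_one, Finset.mem_insert, Finset.mem_singleton, forall_eq_or_imp,
        forall_eq, exists_eq_or_imp, exists_eq_left, Interleave, Prod.forall, hmem, ne_eq,
        Prod.mk.injEq]
    · refine ⟨by omega, by omega, fun a b hab hne => by omega⟩
    · refine ⟨by omega, by omega, fun a b hab hne => by omega⟩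
  · rw [card_chords fun p hp => by have := hS p hp; omega,
      Finset.card_insert_of_notMem (by simp), Finset.card_image_of_injective _ fun a b h => by
        simpa using h, Nat.card_Icc]
    omega

/-- The saturated blocker obtained from the zigzag path `6 1 4 2 0 3 5` in the heptagon by
replacing the vertices `1`, `4`, `5`, `6` by runs of `a`, `r`, `y`, `z` vertices. -/
theorem exists_isSaturatedBlocker_zigzag {a r y z : ℕ} (ha : 1 ≤ a) (hr : 1 ≤ r) (hy : 1 ≤ y)
    (hz : 1 ≤ z) :
    ∃ B, IsSaturatedBlocker (a + r + y + z + 3) B ∧ B.card = a * (r + z) + r + y + 2 := by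
  let n := a + r + y + z + 3
  let R := Finset.Icc (a + 3) (a + r + 2)
  let Y := Finset.Icc (a + r + 3) (a + r + y + 2)
  let Z := Finset.Icc (a + r + y + 3) (a + r + y + z + 2)
  let S : Finset (ℕ × ℕ) := Finset.Icc 1 a ×ˢ (R ∪ Z) ∪ {a + 1} ×ˢ R ∪ {a + 2} ×ˢ Y ∪
    {0} ×ˢ {a + 1, a + 2}
  have hmem : ∀ p q, (p, q) ∈ S ↔
      (1 ≤ p ∧ p ≤ a ∧ ((a + 3 ≤ q ∧ q ≤ a + r + 2) ∨
        (a + r + y + 3 ≤ q ∧ q ≤ a + r + y + z + 2))) ∨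
      (p = a + 1 ∧ a + 3 ≤ q ∧ q ≤ a + r + 2) ∨
      (p = a + 2 ∧ a + r + 3 ≤ q ∧ q ≤ a + r + y + 2) ∨
      (p = 0 ∧ (q = a + 1 ∨ q = a + 2)) := by
    intro p q
    simp only [S, R, Y, Z, Finset.mem_union, Finset.mem_product, Finset.mem_Icc,
      Finset.mem_singleton, Finset.mem_insert]
    omega
  have hS : ∀ p ∈ S, p.1 + 2 ≤ p.2 ∧ p.2 < n ∧ ¬ (p.1 = 0 ∧ p.2 = n - 1) := by
    rintro ⟨p, q⟩ h
    rw [hmem] at h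
    dsimp only [n]
    omega
  refine ⟨chords n S, isSaturatedBlocker_chords (by omega) hS ?_ ?_, ?_⟩
  · intro E h0 hapex
    by_contra! hno
    have hE : ∀ p q, E p q → (p, q) ∉ S := fun p q h hpq => hno (p, q) hpq h
    simp only [hmem] at hE
    -- a shortest side from a set of vertices below `a + 2` to the vertices beyond `a + 2`
    have hshort : ∀ m ≤ n, ∀ P : ℕ → Prop, (∀ p, P p → p ≤ a + 1) →
        (∃ p q, P p ∧ a + 3 ≤ q ∧ q < m ∧ E p q) →
        ∃ p q, P p ∧ a + 3 ≤ q ∧ q < m ∧ E p q ∧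
          ∃ c, p < c ∧ c ≤ a + 2 ∧ ¬ P c ∧ E p c ∧ E c q := by
      intro m hm P hP hex
      have hex' : ∃ l p q, P p ∧ a + 3 ≤ q ∧ q < m ∧ E p q ∧ q - p = l := by
        obtain ⟨p, q, h1, h2, h3, h4⟩ := hex
        exact ⟨_, p, q, h1, h2, h3, h4, rfl⟩
      classical
      obtain ⟨p, q, h1, h2, h3, h4, h5⟩ := Nat.find_spec hex'
      have hp := hP p h1
      obtain ⟨c, hc1, hc2, hc3, hc4⟩ := hapex p q (by omega) (by omega) h4
      refine ⟨p, q, h1, h2, h3, h4, c, hc1, ?_, ?_, hc3, hc4⟩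
      · by_contra hc
        exact Nat.find_min hex' (m := c - p) (by omega)
          ⟨p, c, h1, by omega, by omega, hc3, rfl⟩
      · intro hPc
        exact Nat.find_min hex' (m := q - c) (by omega) ⟨c, q, hPc, h2, h3, hc4, rfl⟩
    obtain ⟨p, q, rfl, hq0, hq, -, c, hc, hc', -, h1, h2⟩ := hshort n le_rfl (fun p => p = 0)
      (by intro p hp; omega) ⟨0, n - 1, rfl, by omega, by omega, h0⟩
    have := hE _ _ h1
    obtain ⟨p, q', hp, hq1, hq2, hpq, d, hd, hd', hPd, -, h4⟩ :=
      hshort n le_rfl (fun p => 1 ≤ p ∧ p ≤ a) (by intro p hp; omega)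
        ⟨c, q, by omega, hq0, hq, h2⟩
    have := hE _ _ hpq
    have := hE _ _ h4
    obtain rfl : d = a + 1 := by omega
    obtain ⟨p, q'', rfl, hq1, hq2, hpq, d, hd, hd', -, -, h6⟩ :=
      hshort (a + r + y + 3) (by omega) (fun p => p = a + 1) (by intro p hp; omega)
        ⟨a + 1, q', rfl, by omega, by omega, h4⟩
    have := hE _ _ hpq
    have := hE _ _ h6
    omega
  · rintro ⟨p, q⟩ h
    rw [hmem] at h
    rcases h with h | h | h | ⟨rfl, rfl | rfl⟩
    · refine ⟨{(0, p), (p, q), (0, q), (a + 2, q), (p, a + 2), (a + 3, q)}, ?_, ?_, ?_⟩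
      · simp only [Finset.mem_insert, Finset.mem_singleton, forall_eq_or_imp, forall_eq]
        omega
      · simp only [Finset.mem_insert, Finset.mem_singleton, forall_eq_or_imp, forall_eq, Interleave]
        refine ⟨?_, ?_, ?_, ?_, ?_, ?_⟩ <;> omega
      · rintro ⟨u, v⟩ huv hne
        rw [hmem] at huv
        rw [Ne, Prod.mk.injEq] at hne
        simp only [Interleave]
        obtain hc | hc | hc | hc | hc | hc | hc : u = 0 ∨
            (0 < u ∧ u < p) ∨
            (u = p ∧ v < q) ∨
            (u = p ∧ q < v) ∨
            (p < u ∧ u < a + 2) ∨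
            (u = a + 2 ∧ v < q) ∨
            (u = a + 2 ∧ q < v) := by omega
        · exact ⟨(p, q), by simp, by omega⟩
        · exact ⟨(0, p), by simp, by omega⟩
        · exact ⟨(a + 2, q), by simp, by omega⟩
        · exact ⟨(0, q), by simp, by omega⟩
        · exact ⟨(p, a + 2), by simp, by omega⟩
        · exact ⟨(a + 3, q), by simp, by omega⟩
        · exact ⟨(p, q), by simp, by omega⟩
    · refine ⟨{(1, a + r + 3), (0, a + r + 3), (a + 1, a + r + 3), (a + 1, q), (q, a + r + 3),
        (a + 2, q)}, ?_, ?_, ?_⟩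
      · simp only [Finset.mem_insert, Finset.mem_singleton, forall_eq_or_imp, forall_eq]
        omega
      · simp only [Finset.mem_insert, Finset.mem_singleton, forall_eq_or_imp, forall_eq, Interleave]
        refine ⟨?_, ?_, ?_, ?_, ?_, ?_⟩ <;> omega
      · rintro ⟨u, v⟩ huv hne
        rw [hmem] at huv
        rw [Ne, Prod.mk.injEq] at hne
        simp only [Interleave]
        obtain hc | hc | hc | hc | hc | hc : u = 0 ∨
            (0 < u ∧ a + r + 3 < v ∧ u ≤ a) ∨
            (0 < u ∧ u ≤ a ∧ v < a + r + 3) ∨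
            (u = a + 1 ∧ v < q) ∨
            (u = a + 1 ∧ q < v) ∨
            u = a + 2 := by omega
        · exact ⟨(1, a + r + 3), by simp, by omega⟩
        · exact ⟨(0, a + r + 3), by simp, by omega⟩
        · exact ⟨(a + 1, a + r + 3), by simp, by omega⟩
        · exact ⟨(a + 2, q), by simp, by omega⟩
        · exact ⟨(q, a + r + 3), by simp, by omega⟩
        · exact ⟨(a + 1, q), by simp, by omega⟩
    · refine ⟨{(1, q), (0, q), (a + 2, q), (a + 3, q)}, ?_, ?_, ?_⟩
      · simp only [Finset.mem_insert, Finset.mem_singleton, forall_eq_or_imp, forall_eq]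
        omega
      · simp only [Finset.mem_insert, Finset.mem_singleton, forall_eq_or_imp, forall_eq, Interleave]
        refine ⟨?_, ?_, ?_, ?_⟩ <;> omega
      · rintro ⟨u, v⟩ huv hne
        rw [hmem] at huv
        rw [Ne, Prod.mk.injEq] at hne
        simp only [Interleave]
        obtain hc | hc | hc | hc : u = 0 ∨
            (0 < u ∧ q < v) ∨
            (0 < u ∧ u < a + 2 ∧ v < q) ∨
            (u = a + 2 ∧ v < q) := by omega
        · exact ⟨(1, q), by simp, by omega⟩
        · exact ⟨(0, q), by simp, by omega⟩
        · exact ⟨(a + 2, q), by simp, by omega⟩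
        · exact ⟨(a + 3, q), by simp, by omega⟩
    · refine ⟨{(0, a + 1), (a + 1, n - 1), (a + 2, n - 1), (a + 3, n - 1)}, ?_, ?_, ?_⟩
      · simp only [Finset.mem_insert, Finset.mem_singleton, forall_eq_or_imp, forall_eq]
        omega
      · simp only [Finset.mem_insert, Finset.mem_singleton, forall_eq_or_imp, forall_eq, Interleave]
        refine ⟨?_, ?_, ?_, ?_⟩ <;> omega
      · rintro ⟨u, v⟩ huv hne
        rw [hmem] at huv
        rw [Ne, Prod.mk.injEq] at hne
        simp only [Interleave]
        obtain hc | hc | hc | hc : u = 0 ∨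
            (0 < u ∧ u ≤ a) ∨
            u = a + 1 ∨
            u = a + 2 := by omega
        · exact ⟨(a + 1, n - 1), by simp, by omega⟩
        · exact ⟨(0, a + 1), by simp, by omega⟩
        · exact ⟨(a + 2, n - 1), by simp, by omega⟩
        · exact ⟨(a + 3, n - 1), by simp, by omega⟩
    · refine ⟨{(0, a + 2), (1, a + 2), (0, a + 3)}, ?_, ?_, ?_⟩
      · simp only [Finset.mem_insert, Finset.mem_singleton, forall_eq_or_imp, forall_eq]
        omega
      · simp only [Finset.mem_insert, Finset.mem_singleton, forall_eq_or_imp, forall_eq, Interleave]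
        refine ⟨?_, ?_, ?_⟩ <;> omega
      · rintro ⟨u, v⟩ huv hne
        rw [hmem] at huv
        rw [Ne, Prod.mk.injEq] at hne
        simp only [Interleave]
        obtain hc | hc | hc : u = 0 ∨
            (0 < u ∧ u < a + 2) ∨
            u = a + 2 := by omega
        · exact ⟨(1, a + 2), by simp, by omega⟩
        · exact ⟨(0, a + 2), by simp, by omega⟩
        · exact ⟨(0, a + 3), by simp, by omega⟩
  · have hR : R.card = r := by simp [R]
    have hY : Y.card = y := by simp [Y]
    have hZ : Z.card = z := by simp [Z]
    have hRZ : Disjoint R Z := by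
      rw [Finset.disjoint_left]
      simp only [R, Z, Finset.mem_Icc]
      omega
    rw [card_chords fun p hp => by have := hS p hp; omega, Finset.card_union_of_disjoint,
      Finset.card_union_of_disjoint, Finset.card_union_of_disjoint]
    · simp only [Finset.card_product, Finset.card_union_of_disjoint hRZ, hR, hY, hZ, Nat.card_Icc,
        Finset.card_singleton, Finset.card_pair (show a + 1 ≠ a + 2 by omega),
        Nat.add_sub_cancel, one_mul]
    all_goals
      rw [Finset.disjoint_left]
      rintro ⟨u, v⟩
      simp only [R, Y, Z, Finset.mem_union, Finset.mem_product, Finset.mem_Icc,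
        Finset.mem_singleton, Finset.mem_insert]
      omega

end ConvexBlocker

open ConvexBlocker in
/-- for every `n ≥ 5` and every `t` with `n - 2 ≤ t` and
`8t ≤ n² + 2n - 11`, there is a saturated blocker of the convex `n`-gon with exactly `t` edges. -/
theorem spectrum_first_range
    (n : ℕ) (hn : 5 ≤ n) (t : ℕ) (ht1 : n - 2 ≤ t) (ht2 : 8 * t + 11 ≤ n ^ 2 + 2 * n) :
    ∃ B : Finset (Sym2 (ZMod n)), IsSaturatedBlocker n B ∧ B.card = t := by
  obtain ⟨D, rfl⟩ := Nat.exists_eq_add_of_le ht1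
  rcases Nat.eq_zero_or_pos D with rfl | hD
  · exact exists_isSaturatedBlocker_star hn
  have hn7 : 7 ≤ n := by
    by_contra hlt
    interval_cases n <;> omega
  obtain ⟨w, hw, hDw⟩ : ∃ w, (1 ≤ w ∧ w + 6 ≤ n) ∧ D ≤ w * (n - 5 - w) := by
    refine ⟨(n - 5) / 2, by omega, ?_⟩
    obtain ⟨k, hk | hk⟩ : ∃ k, n = 2 * k + 5 ∨ n = 2 * k + 6 := ⟨(n - 5) / 2, by omega⟩
    · subst hk
      rw [show (2 * k + 5 - 5) / 2 = k by omega, show 2 * k + 5 - 5 - k = k by omega]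
      rw [show 2 * k + 5 - 2 = 2 * k + 3 by omega] at ht2
      rcases Nat.lt_or_ge k 2 with h | h
      · obtain rfl : k = 1 := by omega
        omega
      · nlinarith
    · subst hk
      rw [show (2 * k + 6 - 5) / 2 = k by omega, show 2 * k + 6 - 5 - k = k + 1 by omega]
      rw [show 2 * k + 6 - 2 = 2 * k + 4 by omega] at ht2
      rcases Nat.lt_or_ge k 2 with h | h
      · obtain rfl : k = 1 := by omega
        omega
      · nlinarith
  have hdiv := Nat.div_add_mod (D - 1) w
  have hmod := Nat.mod_lt (D - 1) (show 0 < w by omega)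
  have hu : (D - 1) / w < n - 5 - w := by
    rw [Nat.div_lt_iff_lt_mul (by omega), mul_comm]
    omega
  generalize (D - 1) / w = u at *
  generalize (D - 1) % w = m at *
  obtain ⟨y, rfl⟩ : ∃ y, n = (u + 1) + (m + 1) + (y + 1) + (w - m) + 3 :=
    ⟨n - 6 - u - w, by omega⟩
  obtain ⟨B, hB, hcard⟩ := exists_isSaturatedBlocker_zigzag (a := u + 1) (r := m + 1)
    (y := y + 1) (z := w - m) (by omega) (by omega) (by omega) (by omega)
  refine ⟨B, hB, hcard.trans ?_⟩
  rw [show m + 1 + (w - m) = w + 1 by omega]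
  have : D = w * u + m + 1 := by omega
  subst this
  have hexp : (u + 1) * (w + 1) = w * u + u + w + 1 := by ring
  omega
end
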